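/- There exist a time T > 0 and smooth functions σ₊, σ₋ : [0,∞) × ℝ² → ℝ, with σ±(t,·) compactly supported for each t, solving the unscreened right-handed system ∂ₜσ₊ − 𝕌(σ₋)·∇σ₊ = 0, ∂ₜσ₋ + 𝕌(σ₊)·∇σ₋ = 0 pointwise, such that the supports of the initial data are disjoint, supp(σ₊(0,·)) ∩ supp(σ₋(0,·)) = ∅, while at time T the interiors of the supports overlap: Int(supp(σ₊(T,·))) ∩ Int(supp(σ₋(T,·))) ≠ ∅. -/

import Mathlib

open MeasureTheory ENNReal Set

noncomputable section

/-- The perpendicular rotation `(z₁, z₂)^⊥ = (−z₂, z₁)` in the plane. -/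
def perp (z : EuclideanSpace ℝ (Fin 2)) : EuclideanSpace ℝ (Fin 2) :=
  (WithLp.equiv 2 (Fin 2 → ℝ)).symm ![-(z 1), z 0]

/-- The Biot–Savart velocity `𝕌(ω)(x) = (1/2π) ∫ ((x−y)^⊥/|x−y|²) ω(y) dy`. -/
def biotSavart (ω : EuclideanSpace ℝ (Fin 2) → ℝ) (x : EuclideanSpace ℝ (Fin 2)) :
    EuclideanSpace ℝ (Fin 2) :=
  (1 / (2 * Real.pi)) • ∫ y, (ω y / ‖x - y‖ ^ 2) • perp (x - y)

/-- Composition with a fixed continuous map, acting on continuous paths. -/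
def pathComp {F G : Type} [NormedAddCommGroup F] [NormedAddCommGroup G]
    (W : F → G) (hW : Continuous W) (X : C(unitInterval, F)) : C(unitInterval, G) :=
  ⟨fun s => W (X s), hW.comp X.continuous⟩

/-- Pointwise application of a path of linear maps to a path of vectors. -/
def pathApply (F G : Type) [NormedAddCommGroup F] [NormedSpace ℝ F]
    [NormedAddCommGroup G] [NormedSpace ℝ G] :
    C(unitInterval, F →L[ℝ] G) →L[ℝ] C(unitInterval, F) →L[ℝ] C(unitInterval, G) :=
  LinearMap.mkContinuous₂
    (LinearMap.mk₂ ℝ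
      (fun (A : C(unitInterval, F →L[ℝ] G)) (X : C(unitInterval, F)) =>
        (⟨fun s => A s (X s), A.continuous.clm_apply X.continuous⟩ : C(unitInterval, G)))
      (fun _ _ _ => by ext; simp) (fun _ _ _ => by ext; simp)
      (fun _ _ _ => by ext; simp) (fun _ _ _ => by ext; simp)) 1 (fun A X => by
        rw [one_mul, ContinuousMap.norm_le _ (by positivity)]
        intro s
        exact (ContinuousLinearMap.le_opNorm _ _).trans
          (mul_le_mul (A.norm_coe_le_norm s) (X.norm_coe_le_norm s) (by positivity)
            (by positivity)))

@[simp] lemma pathApply_apply {F G : Type} [NormedAddCommGroup F] [NormedSpace ℝ F]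
    [NormedAddCommGroup G] [NormedSpace ℝ G] (A : C(unitInterval, F →L[ℝ] G))
    (X : C(unitInterval, F)) (s : unitInterval) : pathApply F G A X s = A s (X s) := rfl

lemma continuous_pathComp {F G : Type} [NormedAddCommGroup F] [NormedAddCommGroup G]
    (W : F → G) (hW : Continuous W) : Continuous (pathComp W hW) :=
  ContinuousMap.continuous_postcomp (⟨W, hW⟩ : C(F, G))

lemma hasFDerivAt_pathComp {F G : Type} [NormedAddCommGroup F] [NormedSpace ℝ F]
    [NormedAddCommGroup G] [NormedSpace ℝ G] {W : F → G} (hW : ContDiff ℝ 1 W)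
    (X : C(unitInterval, F)) :
    HasFDerivAt (pathComp W hW.continuous)
      (pathApply F G (pathComp (fderiv ℝ W) (hW.continuous_fderiv one_ne_zero) X)) X := by
  rw [hasFDerivAt_iff_isLittleO, Asymptotics.isLittleO_iff]
  intro c hc
  have hc' := (continuous_pathComp _ (hW.continuous_fderiv one_ne_zero)).continuousAt (x := X)
  obtain ⟨δ, hδ, hball⟩ := Metric.continuousAt_iff.1 hc' c hc
  filter_upwards [Metric.ball_mem_nhds X hδ] with Y hY
  rw [ContinuousMap.norm_le _ (by positivity)]
  intro s
  have hseg : ∀ z ∈ segment ℝ (X s) (Y s),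
      ‖fderiv ℝ W z - fderiv ℝ W (X s)‖ ≤ c := by
    rintro z ⟨a, b, ha, hb, hab, rfl⟩
    have hZ : dist (a • X + b • Y) X < δ := by
      have : a • X + b • Y - X = b • (Y - X) := by
        rw [← sub_eq_zero]; have : a = 1 - b := by linarith
        subst this; module
      rw [dist_eq_norm, this, norm_smul, Real.norm_of_nonneg hb, ← dist_eq_norm]
      have h1 : dist Y X < δ := hY
      have : b ≤ 1 := by linarith
      nlinarith [dist_nonneg (x := Y) (y := X)]
    have h2 := hball hZ
    have h3 := ContinuousMap.dist_apply_le_dist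
      (f := pathComp (fderiv ℝ W) (hW.continuous_fderiv one_ne_zero) (a • X + b • Y))
      (g := pathComp (fderiv ℝ W) (hW.continuous_fderiv one_ne_zero) X) s
    rw [← dist_eq_norm]
    exact h3.trans h2.le
  have hmv := (convex_segment (X s) (Y s)).norm_image_sub_le_of_norm_hasFDerivWithin_le'
    (f := W) (f' := fderiv ℝ W) (φ := fderiv ℝ W (X s)) (C := c)
    (fun z _ => ((hW.differentiable one_ne_zero) z).hasFDerivAt.hasFDerivWithinAt) hseg
    (left_mem_segment ℝ _ _) (right_mem_segment ℝ _ _)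
  exact hmv.trans (mul_le_mul_of_nonneg_left ((Y - X).norm_coe_le_norm s) hc.le)

lemma contDiff_pathComp_nat {F : Type} [NormedAddCommGroup F] [NormedSpace ℝ F] (n : ℕ) :
    ∀ {G : Type} [NormedAddCommGroup G] [NormedSpace ℝ G] {W : F → G}
      (hW : ContDiff ℝ (⊤ : ℕ∞) W), ContDiff ℝ n (pathComp W hW.continuous) := by
  induction n with
  | zero => intro G _ _ W hW; exact contDiff_zero.2 (continuous_pathComp W _)
  | succ n ih =>
    intro G _ _ W hW
    have hW' : ContDiff ℝ (⊤ : ℕ∞) (fderiv ℝ W) := hW.fderiv_right (by simp)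
    have hd := fun X => hasFDerivAt_pathComp (hW.of_le (by exact_mod_cast le_top)) X
    refine (contDiff_succ_iff_hasFDerivAt (n := n)).2 ?_
    refine ⟨fun X => pathApply F G (pathComp (fderiv ℝ W) (hW'.continuous) X),
      ?_, hd⟩
    have h := ContinuousLinearMap.contDiff (𝕜 := ℝ) (E := C(unitInterval, F →L[ℝ] G))
      (F := C(unitInterval, F) →L[ℝ] C(unitInterval, G)) (n := n) (pathApply F G)
    exact h.comp (ih hW')

lemma contDiff_pathComp {F G : Type} [NormedAddCommGroup F] [NormedSpace ℝ F]
    [NormedAddCommGroup G] [NormedSpace ℝ G] {W : F → G} (hW : ContDiff ℝ (⊤ : ℕ∞) W) :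
    ContDiff ℝ (⊤ : ℕ∞) (pathComp W hW.continuous) :=
  contDiff_infty.2 fun n => contDiff_pathComp_nat n hW

/-- The Volterra operator `X ↦ ∫₀ˢ X` on continuous paths. -/
def pathIntegral (F : Type) [NormedAddCommGroup F] [NormedSpace ℝ F] :
    C(unitInterval, F) →L[ℝ] C(unitInterval, F) :=
  LinearMap.mkContinuous
    { toFun := fun X => ⟨fun s => ∫ r in (0:ℝ)..s, IccExtend zero_le_one X r, by
        have h : Continuous (IccExtend zero_le_one X) := X.continuous.Icc_extend'
        exact (intervalIntegral.continuous_primitive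
          (fun a b => h.intervalIntegrable a b) 0).comp continuous_subtype_val⟩
      map_add' := by
        intro X Y; ext s
        have hX : Continuous (IccExtend zero_le_one X) := X.continuous.Icc_extend'
        have hY : Continuous (IccExtend zero_le_one Y) := Y.continuous.Icc_extend'
        exact intervalIntegral.integral_add (hX.intervalIntegrable _ _)
          (hY.intervalIntegrable _ _)
      map_smul' := by
        intro c X; ext s
        exact intervalIntegral.integral_smul c _ } 1 (by
    intro X
    rw [one_mul, ContinuousMap.norm_le _ (by positivity)]
    intro s
    refine (intervalIntegral.norm_integral_le_of_norm_le_const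
      (C := ‖X‖) (fun r _ => X.norm_coe_le_norm _)).trans ?_
    rw [sub_zero, abs_of_nonneg s.2.1]
    exact mul_le_of_le_one_right (by positivity) s.2.2)

lemma pathIntegral_apply {F : Type} [NormedAddCommGroup F] [NormedSpace ℝ F]
    (X : C(unitInterval, F)) (s : unitInterval) :
    pathIntegral F X s = ∫ r in (0:ℝ)..s, IccExtend zero_le_one X r := rfl

lemma norm_volterra_pow_le {F : Type} [NormedAddCommGroup F] [NormedSpace ℝ F]
    (A : C(unitInterval, F →L[ℝ] F)) (n : ℕ) (X : C(unitInterval, F)) (s : unitInterval) :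
    ‖(((pathIntegral F).comp (pathApply F F A)) ^ n) X s‖
      ≤ (‖A‖ * s) ^ n / n.factorial * ‖X‖ := by
  induction n generalizing s with
  | zero => simpa using X.norm_coe_le_norm s
  | succ n ih =>
    rw [pow_succ', mul_apply_eq_comp, ContinuousLinearMap.comp_apply,
      pathIntegral_apply]
    set Y := (((pathIntegral F).comp (pathApply F F A)) ^ n) X
    have hintegral : ∫ r in (0:ℝ)..s, ‖A‖ * ((‖A‖ * r) ^ n / n.factorial * ‖X‖)
        = (‖A‖ * s) ^ (n + 1) / (n + 1).factorial * ‖X‖ := by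
      have : ∀ r : ℝ, ‖A‖ * ((‖A‖ * r) ^ n / n.factorial * ‖X‖)
          = (‖A‖ ^ (n + 1) / n.factorial * ‖X‖) * r ^ n := by
        intro r; rw [mul_pow]; ring
      simp_rw [this]
      rw [intervalIntegral.integral_const_mul, integral_pow, Nat.factorial_succ]
      have : (n.factorial : ℝ) ≠ 0 := by positivity
      push_cast
      field_simp
      ring
    rw [← hintegral]
    refine intervalIntegral.norm_integral_le_of_norm_le s.2.1 ?_
      (Continuous.intervalIntegrable (by fun_prop) _ _)
    refine Filter.Eventually.of_forall fun r hr => ?_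
    have hr1 : r ∈ Icc (0:ℝ) 1 := ⟨hr.1.le, hr.2.trans s.2.2⟩
    rw [IccExtend_of_mem _ _ hr1, pathApply_apply]
    refine (ContinuousLinearMap.le_opNorm _ _).trans ?_
    exact mul_le_mul (A.norm_coe_le_norm _) (ih ⟨r, hr1⟩) (norm_nonneg _) (by positivity)

lemma isUnit_one_sub_volterra {F : Type} [NormedAddCommGroup F] [NormedSpace ℝ F]
    [CompleteSpace F] (A : C(unitInterval, F →L[ℝ] F)) :
    IsUnit (1 - (pathIntegral F).comp (pathApply F F A)) := by
  set Q := (pathIntegral F).comp (pathApply F F A) with hQ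
  obtain ⟨n, hn⟩ : ∃ n : ℕ, ‖A‖ ^ n / n.factorial < 1 :=
    ((FloorSemiring.tendsto_pow_div_factorial_atTop ‖A‖).eventually
      (gt_mem_nhds one_pos)).exists
  have hQn : ‖Q ^ n‖ < 1 := by
    refine lt_of_le_of_lt (ContinuousLinearMap.opNorm_le_bound _ (by positivity)
      fun X => ?_) hn
    rw [ContinuousMap.norm_le _ (by positivity)]
    intro s
    refine (norm_volterra_pow_le A n X s).trans ?_
    have h0 := s.2.1
    have h1 := s.2.2
    gcongr
    exact mul_le_of_le_one_right (by positivity) h1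
  have hu : IsUnit (1 - Q ^ n) := (Units.oneSub (Q ^ n) hQn).isUnit
  have hgeom : (1 - Q) * (∑ i ∈ Finset.range n, Q ^ i) = 1 - Q ^ n := mul_neg_geom_sum Q n
  have hcomm : Commute (1 - Q) (∑ i ∈ Finset.range n, Q ^ i) := by
    have : (∑ i ∈ Finset.range n, Q ^ i) * (1 - Q) = 1 - Q ^ n := geom_sum_mul_neg Q n
    exact hgeom.trans this.symm
  rw [← hgeom] at hu
  exact (hcomm.isUnit_mul_iff.1 hu).1

lemma exists_lipschitzOn_ball {F : Type} [NormedAddCommGroup F] [NormedSpace ℝ F]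
    [ProperSpace F] {W : F → F} (hW : ContDiff ℝ 1 W) (R : ℝ) :
    ∃ K : NNReal, LipschitzOnWith K W (Metric.closedBall 0 R) := by
  obtain ⟨C, hC⟩ := (isCompact_closedBall (0:F) R).exists_bound_of_continuousOn
    (hW.continuous_fderiv one_ne_zero).continuousOn
  refine ⟨C.toNNReal, (convex_closedBall (0:F) R).lipschitzOnWith_of_nnnorm_fderiv_le
    (𝕜 := ℝ) (fun x _ => hW.differentiable one_ne_zero x) fun x hx => ?_⟩
  exact NNReal.le_toNNReal_of_coe_le (hC x hx)

lemma ode_unique_Icc {F : Type} [NormedAddCommGroup F] [NormedSpace ℝ F]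
    [ProperSpace F] {W : F → F} (hW : ContDiff ℝ 1 W) (c : ℝ) {x y : ℝ → F}
    (hxc : ContinuousOn x (Icc 0 1)) (hyc : ContinuousOn y (Icc 0 1))
    (hx : ∀ t ∈ Ico (0:ℝ) 1, HasDerivWithinAt x (c • W (x t)) (Ici t) t)
    (hy : ∀ t ∈ Ico (0:ℝ) 1, HasDerivWithinAt y (c • W (y t)) (Ici t) t)
    (h0 : x 0 = y 0) : EqOn x y (Icc 0 1) := by
  obtain ⟨R₁, hR₁⟩ := isCompact_Icc.exists_bound_of_continuousOn hxc
  obtain ⟨R₂, hR₂⟩ := isCompact_Icc.exists_bound_of_continuousOn hyc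
  obtain ⟨K, hK⟩ := exists_lipschitzOn_ball (W := fun z => c • W z) (hW.const_smul c) (max R₁ R₂)
  refine ODE_solution_unique_of_mem_Icc_right (v := fun _ z => c • W z)
    (s := fun _ => Metric.closedBall 0 (max R₁ R₂)) (K := K) (fun _ _ => hK) hxc hx ?_ hyc hy ?_ h0
  · intro t ht
    simpa using Or.inl (hR₁ t (Ico_subset_Icc_self ht))
  · intro t ht
    simpa using Or.inr (hR₂ t (Ico_subset_Icc_self ht))

lemma integralCurve_unique {F : Type} [NormedAddCommGroup F] [NormedSpace ℝ F]
    [ProperSpace F] {W : F → F} (hW : ContDiff ℝ 1 W) {x y : ℝ → F}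
    (hx : ∀ t, HasDerivAt x (W (x t)) t) (hy : ∀ t, HasDerivAt y (W (y t)) t)
    (h0 : x 0 = y 0) : x = y := by
  funext t
  have key : ∀ z : ℝ → F, (∀ t, HasDerivAt z (W (z t)) t) →
      ∀ s, HasDerivAt (fun s => z (t * s)) (t • W (z (t * s))) s := by
    intro z hz s
    have := (hz (t * s)).scomp s ((hasDerivAt_id s).const_mul t)
    simpa [Function.comp_def] using this
  have := ode_unique_Icc hW t (x := fun s => x (t * s)) (y := fun s => y (t * s))
    (fun s _ => (key x hx s).continuousAt.continuousWithinAt)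
    (fun s _ => (key y hy s).continuousAt.continuousWithinAt)
    (fun s _ => (key x hx s).hasDerivWithinAt) (fun s _ => (key y hy s).hasDerivWithinAt)
    (by simpa using h0) (right_mem_Icc.2 zero_le_one)
  simpa using this

/-- The equation whose zeros are rescaled integral curves. -/
def curveEq {F : Type} [NormedAddCommGroup F] [NormedSpace ℝ F] (W : F → F)
    (hW : Continuous W) (q : (ℝ × F) × C(unitInterval, F)) : C(unitInterval, F) :=
  q.2 - ContinuousLinearMap.const ℝ unitInterval q.1.2
    - q.1.1 • pathIntegral F (pathComp W hW q.2)

lemma contDiff_curveEq {F : Type} [NormedAddCommGroup F] [NormedSpace ℝ F] {W : F → F}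
    (hW : ContDiff ℝ (⊤ : ℕ∞) W) : ContDiff ℝ (⊤ : ℕ∞) (curveEq W hW.continuous) := by
  have h1 : ContDiff ℝ (⊤ : ℕ∞)
      (fun q : (ℝ × F) × C(unitInterval, F) => pathIntegral F (pathComp W hW.continuous q.2)) :=
    (pathIntegral F).contDiff.comp ((contDiff_pathComp hW).comp contDiff_snd)
  have h2 : ContDiff ℝ (⊤ : ℕ∞)
      (fun q : (ℝ × F) × C(unitInterval, F) => ContinuousLinearMap.const ℝ unitInterval q.1.2) :=
    (ContinuousLinearMap.contDiff _).comp (contDiff_snd.comp contDiff_fst)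
  exact (contDiff_snd.sub h2).sub ((contDiff_fst.comp contDiff_fst).smul h1)

lemma isInvertible_fderiv_curveEq {F : Type} [NormedAddCommGroup F] [NormedSpace ℝ F]
    [CompleteSpace F] {W : F → F} (hW : ContDiff ℝ (⊤ : ℕ∞) W)
    (q : (ℝ × F) × C(unitInterval, F)) :
    (fderiv ℝ (curveEq W hW.continuous) q ∘L
      ContinuousLinearMap.inr ℝ (ℝ × F) C(unitInterval, F)).IsInvertible := by
  set A := q.1.1 • pathComp (fderiv ℝ W)
    ((hW.of_le (by exact_mod_cast le_top) : ContDiff ℝ 1 W).continuous_fderiv one_ne_zero) q.2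
  have hd : HasFDerivAt (fun X => curveEq W hW.continuous (q.1, X))
      (1 - (pathIntegral F).comp (pathApply F F A)) q.2 := by
    have h1 := (pathIntegral F).hasFDerivAt.comp q.2
      (hasFDerivAt_pathComp (hW.of_le (by exact_mod_cast le_top)) q.2)
    have h2 := ((hasFDerivAt_id (𝕜 := ℝ) q.2).sub_const
      (ContinuousLinearMap.const ℝ unitInterval q.1.2)).sub (h1.const_smul q.1.1)
    refine h2.congr_fderiv ?_
    ext X s
    simp [A]
  have hc : fderiv ℝ (curveEq W hW.continuous) q ∘L
      ContinuousLinearMap.inr ℝ (ℝ × F) C(unitInterval, F)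
      = 1 - (pathIntegral F).comp (pathApply F F A) := by
    have h3 := ((contDiff_curveEq hW).differentiable (by simp) q).hasFDerivAt.comp q.2
      (f := fun X => (q.1, X)) (hasFDerivAt_prodMk_right q.1 q.2)
    exact h3.unique hd
  rw [hc]
  obtain ⟨u, hu⟩ := isUnit_one_sub_volterra A
  exact ⟨ContinuousLinearEquiv.unitsEquiv ℝ _ u, by ext1 X; rw [← hu]; rfl⟩

lemma curveEq_eq_zero_of_integralCurve {F : Type} [NormedAddCommGroup F] [NormedSpace ℝ F]
    [ProperSpace F] {W : F → F} (hW : Continuous W) {γ : ℝ → F}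
    (hγ : ∀ t, HasDerivAt γ (W (γ t)) t) (t : ℝ) (hγc : Continuous γ) :
    curveEq W hW ((t, γ 0), ⟨fun s => γ (t * s), by fun_prop⟩) = 0 := by
  ext s
  have hder : ∀ s : ℝ, HasDerivAt (fun s => γ (t * s)) (t • W (γ (t * s))) s := by
    intro s
    have := (hγ (t * s)).scomp s ((hasDerivAt_id s).const_mul t)
    simpa [Function.comp_def] using this
  have hintegral := intervalIntegral.integral_eq_sub_of_hasDerivAt (a := (0:ℝ)) (b := s)
    (fun r _ => hder r) (Continuous.intervalIntegrable (by fun_prop) _ _)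
  rw [intervalIntegral.integral_smul] at hintegral
  have h2 : ∫ r in (0:ℝ)..s, IccExtend zero_le_one (pathComp W hW
      ⟨fun s : unitInterval => γ (t * s), by fun_prop⟩) r = ∫ r in (0:ℝ)..s, W (γ (t * r)) := by
    refine intervalIntegral.integral_congr fun r hr => ?_
    rw [uIcc_of_le s.2.1] at hr
    have hr1 : r ∈ Icc (0:ℝ) 1 := ⟨hr.1, hr.2.trans s.2.2⟩
    simp only [IccExtend_of_mem _ _ hr1]
    rfl
  simp only [curveEq, ContinuousMap.sub_apply, ContinuousMap.smul_apply, pathIntegral_apply, h2]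
  rw [hintegral]
  have h3 : ContinuousLinearMap.const ℝ unitInterval (γ 0) s = γ 0 := rfl
  rw [h3]
  simp

lemma eq_of_curveEq_eq_zero {F : Type} [NormedAddCommGroup F] [NormedSpace ℝ F]
    [ProperSpace F] {W : F → F} (hW : ContDiff ℝ 1 W) {γ : ℝ → F}
    (hγ : ∀ t, HasDerivAt γ (W (γ t)) t) (t : ℝ) (X : C(unitInterval, F))
    (hX : curveEq W hW.continuous ((t, γ 0), X) = 0) : X 1 = γ t := by
  have hWX : Continuous (IccExtend zero_le_one (pathComp W hW.continuous X)) :=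
    (pathComp W hW.continuous X).continuous.Icc_extend'
  have hval : ∀ s : unitInterval, X s
      = γ 0 + t • ∫ r in (0:ℝ)..s, IccExtend zero_le_one (pathComp W hW.continuous X) r := by
    intro s
    have := DFunLike.congr_fun hX s
    simp only [curveEq, ContinuousMap.sub_apply, ContinuousMap.smul_apply,
      pathIntegral_apply] at this
    rw [sub_sub, ContinuousMap.zero_apply, sub_eq_zero] at this
    exact this
  set Y : ℝ → F := fun s =>
    γ 0 + t • ∫ r in (0:ℝ)..s, IccExtend zero_le_one (pathComp W hW.continuous X) r
  have hY : ∀ s, HasDerivAt Y (t • IccExtend zero_le_one (pathComp W hW.continuous X) s) s :=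
    fun s => ((hWX.integral_hasStrictDerivAt 0 s).hasDerivAt.const_smul t).const_add _
  have hYX : ∀ s ∈ Ico (0:ℝ) 1,
      IccExtend zero_le_one (pathComp W hW.continuous X) s = W (Y s) := by
    intro s hs
    rw [IccExtend_of_mem _ _ (Ico_subset_Icc_self hs)]
    exact congrArg W (hval ⟨s, _⟩)
  have hder : ∀ s : ℝ, HasDerivAt (fun s => γ (t * s)) (t • W (γ (t * s))) s := by
    intro s
    have := (hγ (t * s)).scomp s ((hasDerivAt_id s).const_mul t)
    simpa [Function.comp_def] using this
  have := ode_unique_Icc hW t (x := Y) (y := fun s => γ (t * s))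
    (fun s _ => (hY s).continuousAt.continuousWithinAt)
    (fun s _ => (hder s).continuousAt.continuousWithinAt)
    (fun s hs => by rw [← hYX s hs]; exact (hY s).hasDerivWithinAt)
    (fun s _ => (hder s).hasDerivWithinAt) (by simp [Y]) (right_mem_Icc.2 zero_le_one)
  have h1 := hval 1
  simp only [mul_one] at this
  rw [← this]
  exact h1

/-- A smooth complete vector field has a smooth flow. -/
theorem exists_smooth_flow {F : Type} [NormedAddCommGroup F] [NormedSpace ℝ F]
    [ProperSpace F] {W : F → F} (hW : ContDiff ℝ (⊤ : ℕ∞) W)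
    (hc : ∀ p, ∃ γ : ℝ → F, γ 0 = p ∧ ∀ t, HasDerivAt γ (W (γ t)) t) :
    ∃ Φ : ℝ → F → F, ContDiff ℝ (⊤ : ℕ∞) (fun q : ℝ × F => Φ q.1 q.2) ∧ (∀ a, Φ 0 a = a) ∧
      (∀ t a, HasDerivAt (fun s => Φ s a) (W (Φ t a)) t) ∧
      (∀ s t a, Φ s (Φ t a) = Φ (s + t) a) := by
  have hW1 : ContDiff ℝ 1 W := hW.of_le (by exact_mod_cast le_top)
  choose γ hγ0 hγ using hc
  have hcont : ∀ a, Continuous (γ a) := fun a =>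
    continuous_iff_continuousAt.2 fun t => (hγ a t).continuousAt
  refine ⟨fun t a => γ a t, ?_, hγ0, fun t a => hγ a t, ?_⟩
  · rw [contDiff_iff_contDiffAt]
    rintro ⟨t, a⟩
    set X : C(unitInterval, F) := ⟨fun s => γ a (t * s), by have := hcont a; fun_prop⟩ with hX
    have hz : curveEq W hW.continuous ((t, a), X) = 0 := by
      have := curveEq_eq_zero_of_integralCurve hW.continuous (hγ a) t (hcont a)
      rwa [hγ0] at this
    have cdf : ContDiffAt ℝ (⊤ : ℕ∞) (curveEq W hW.continuous) ((t, a), X) :=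
      (contDiff_curveEq hW).contDiffAt
    have if₂ := isInvertible_fderiv_curveEq hW ((t, a), X)
    have hs := cdf.contDiffAt_implicitFunction (by simp) if₂
    have hev := cdf.eventually_apply_implicitFunction (by simp) if₂
    set ψ := cdf.implicitFunction (by simp) if₂
    have hev1 := ContinuousLinearMap.contDiff (𝕜 := ℝ) (E := C(unitInterval, F)) (F := F)
      (n := (⊤ : ℕ∞)) (ContinuousMap.evalCLM ℝ (1 : unitInterval))
    have hE : ContDiffAt ℝ (⊤ : ℕ∞) (fun q => ψ q 1) (t, a) :=
      hev1.contDiffAt.comp (t, a) hs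
    refine hE.congr_of_eventuallyEq ?_
    filter_upwards [hev] with q hq
    rw [hz] at hq
    refine (eq_of_curveEq_eq_zero hW1 (hγ q.2) q.1 (ψ q) ?_).symm
    rw [hγ0]
    exact hq
  · intro s t a
    have := integralCurve_unique hW1 (x := γ (γ a t)) (y := fun s => γ a (s + t))
      (hγ _) (fun s => by simpa using (hγ a (s + t)).comp_add_const s t) (by simp [hγ0])
    exact congrFun this s

lemma exists_integralCurve_of_bounded_on_slabs {E : Type} [NormedAddCommGroup E]
    [NormedSpace ℝ E] [FiniteDimensional ℝ E] {V : ℝ × E → E} (hV : ContDiff ℝ (⊤ : ℕ∞) V)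
    (hb : ∀ T : ℝ, ∃ M : ℝ, ∀ p : ℝ × E, |p.1| ≤ T → ‖V p‖ ≤ M) (p : ℝ × E) :
    ∃ γ : ℝ → ℝ × E, γ 0 = p ∧ ∀ t, HasDerivAt γ ((1 : ℝ), V (γ t)) t := by
  have : ProperSpace E := FiniteDimensional.proper_real E
  have hV1 : ContDiff ℝ 1 V := hV.of_le (by exact_mod_cast le_top)
  have hv : ContDiff ℝ 1 (fun q : ℝ × E => ((1 : ℝ), V q)) := contDiff_const.prodMk hV1
  have key := (exists_isMIntegralCurve_iff_exists_isMIntegralCurveOn_Ioo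
    (I := modelWithCornersSelf ℝ (ℝ × E)) (M := ℝ × E) (v := fun q => ((1 : ℝ), V q))
    (contMDiff_vectorSpace_iff_contDiff.2 hv) p).2 ?_
  · obtain ⟨γ, h0, hγ⟩ := key
    refine ⟨γ, h0, fun t => ?_⟩
    have h2 : HasFDerivAt γ (ContinuousLinearMap.smulRight (1 : ℝ →L[ℝ] ℝ)
      ((1 : ℝ), V (γ t))) t := (hγ t).hasFDerivAt
    have h3 := h2.hasDerivAt
    rwa [ContinuousLinearMap.smulRight_apply, one_apply_eq_self, one_smul] at h3
  intro N
  rcases le_or_gt N 0 with hN | hN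
  · refine ⟨fun _ => p, rfl, fun t ht => ?_⟩
    have h1 := ht.1
    have h2 := ht.2
    linarith
  obtain ⟨M, hM⟩ := hb (|p.1| + N)
  have hM0 : 0 ≤ M := (norm_nonneg _).trans (hM (p.1, 0) (by simpa using hN.le))
  have hN' : 0 ≤ M * N := by positivity
  -- Lipschitz constant in space
  obtain ⟨C, hC⟩ := ((isCompact_Icc (a := p.1 - N) (b := p.1 + N)).prod
    (isCompact_closedBall p.2 (M * N))).exists_bound_of_continuousOn
    (hV1.continuous_fderiv one_ne_zero).continuousOn
  have hPL : IsPicardLindelof (fun (t : ℝ) (x : E) => V (p.1 + t, x)) (tmin := -N) (tmax := N)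
      ⟨0, by constructor <;> linarith⟩ p.2 (⟨M * N, hN'⟩ : NNReal) 0 (⟨M, hM0⟩ : NNReal)
      C.toNNReal := by
    refine ⟨fun t ht => ?_, fun x _ => ?_, fun t ht x _ => ?_, ?_⟩
    · have hd : ∀ x : E, HasFDerivAt (fun x => V (p.1 + t, x))
          ((fderiv ℝ V (p.1 + t, x)).comp (ContinuousLinearMap.inr ℝ ℝ E)) x := fun x =>
        ((hV1.differentiable one_ne_zero _).hasFDerivAt).comp x (hasFDerivAt_prodMk_right _ _)
      refine (convex_closedBall p.2 (M * N)).lipschitzOnWith_of_nnnorm_hasFDerivWithin_le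
        (fun x _ => (hd x).hasFDerivWithinAt) fun x hx => ?_
      refine NNReal.le_toNNReal_of_coe_le ?_
      have hmem : ((p.1 + t, x) : ℝ × E) ∈ Icc (p.1 - N) (p.1 + N) ×ˢ
          Metric.closedBall p.2 (M * N) :=
        ⟨⟨by have := ht.1; simp only; linarith, by have := ht.2; simp only; linarith⟩, hx⟩
      have h1 := hC _ hmem
      refine (ContinuousLinearMap.opNorm_comp_le _ _).trans ?_
      calc _ ≤ ‖fderiv ℝ V (p.1 + t, x)‖ * 1 := by
            gcongr; exact ContinuousLinearMap.norm_inr_le_one ℝ ℝ E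
        _ ≤ C := by simpa using h1
    · exact Continuous.continuousOn (by have := hV.continuous; fun_prop)
    · refine hM _ ((abs_add_le _ _).trans ?_)
      simpa using abs_le.2 ht
    · simp only [sub_zero, zero_sub, neg_neg, max_self, NNReal.coe_zero]
      exact le_refl _
  obtain ⟨α, hα0, hα⟩ := hPL.exists_eq_forall_mem_Icc_hasDerivWithinAt₀
  refine ⟨fun t => (p.1 + t, α t), ?_, fun t ht => ?_⟩
  · ext
    · simp
    · simpa using hα0
  · have h1 := (hα t (Ioo_subset_Icc_self ht)).mono Ioo_subset_Icc_self
    have h2 : HasDerivWithinAt (fun t : ℝ => p.1 + t) 1 (Ioo (-N) N) t :=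
      ((hasDerivAt_id t).const_add p.1).hasDerivWithinAt
    exact (h2.prodMk h1).hasFDerivWithinAt.hasMFDerivWithinAt

/-- The field `V` on space-time has global trajectories through every point. -/
def HasTrajectories {E : Type} [NormedAddCommGroup E] [NormedSpace ℝ E] (V : ℝ × E → E) : Prop :=
  ∀ p : ℝ × E, ∃ X : ℝ → E, X p.1 = p.2 ∧ ∀ s, HasDerivAt X (V (s, X s)) s

lemma HasTrajectories.of_bounded_on_slabs {E : Type} [NormedAddCommGroup E]
    [NormedSpace ℝ E] [FiniteDimensional ℝ E] {V : ℝ × E → E} (hV : ContDiff ℝ (⊤ : ℕ∞) V)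
    (hb : ∀ T : ℝ, ∃ M : ℝ, ∀ p : ℝ × E, |p.1| ≤ T → ‖V p‖ ≤ M) : HasTrajectories V := by
  intro p
  obtain ⟨γ, h0, hγ⟩ := exists_integralCurve_of_bounded_on_slabs hV hb p
  have hfst : ∀ t, (γ t).1 = p.1 + t := by
    have hd : ∀ t, HasDerivAt (fun t => (γ t).1 - t) 0 t := fun t =>
      ((hasFDerivAt_fst.comp_hasDerivAt t (hγ t)).sub (hasDerivAt_id t)).congr_deriv (by simp)
    intro t
    have := is_const_of_deriv_eq_zero (fun t => (hd t).differentiableAt)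
      (fun t => (hd t).deriv) t 0
    simp only [h0] at this
    linarith
  refine ⟨fun s => (γ (s - p.1)).2, by simp [h0], fun s => ?_⟩
  have h1 := hasFDerivAt_snd (𝕜 := ℝ).comp_hasDerivAt (s - p.1) (hγ (s - p.1))
  have h2 := h1.comp_sub_const s p.1
  have h3 : γ (s - p.1) = (s, (γ (s - p.1)).2) := by
    ext
    · simp [hfst]
    · rfl
  rw [← h3]
  exact h2

lemma hasDerivAt_along {E G : Type} [NormedAddCommGroup E] [NormedSpace ℝ E]
    [NormedAddCommGroup G] [NormedSpace ℝ G] {V : ℝ × E → E} {w : ℝ × E → G}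
    (hw : Differentiable ℝ w) {X : ℝ → E} (hX : ∀ s, HasDerivAt X (V (s, X s)) s) (s : ℝ) :
    HasDerivAt (fun s => w (s, X s)) (fderiv ℝ w (s, X s) (1, V (s, X s))) s :=
  (hw (s, X s)).hasFDerivAt.comp_hasDerivAt s ((hasDerivAt_id s).prodMk (hX s))

lemma const_along {E G : Type} [NormedAddCommGroup E] [NormedSpace ℝ E]
    [NormedAddCommGroup G] [NormedSpace ℝ G] {V : ℝ × E → E} {w : ℝ × E → G}
    (hw : Differentiable ℝ w) (hV : ∀ p, fderiv ℝ w p (1, V p) = 0) {X : ℝ → E}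
    (hX : ∀ s, HasDerivAt X (V (s, X s)) s) (s t : ℝ) : w (s, X s) = w (t, X t) :=
  is_const_of_deriv_eq_zero (f := fun s => w (s, X s))
    (fun s => (hasDerivAt_along hw hX s).differentiableAt)
    (fun s => by rw [(hasDerivAt_along hw hX s).deriv, hV]) s t

/-- Solvability of the linear transport equation in the smooth class. -/
theorem exists_transport {E : Type} [NormedAddCommGroup E]
    [NormedSpace ℝ E] [FiniteDimensional ℝ E] {V : ℝ × E → E} (hV : ContDiff ℝ (⊤ : ℕ∞) V)
    (hb : ∀ T : ℝ, ∃ M : ℝ, ∀ p : ℝ × E, |p.1| ≤ T → ‖V p‖ ≤ M)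
    {σ₀ : E → ℝ} (hσ₀ : ContDiff ℝ (⊤ : ℕ∞) σ₀) :
    ∃ σ : ℝ × E → ℝ, ContDiff ℝ (⊤ : ℕ∞) σ ∧ (∀ x, σ (0, x) = σ₀ x) ∧
      ∀ p, fderiv ℝ σ p (1, V p) = 0 := by
  have : ProperSpace E := FiniteDimensional.proper_real E
  obtain ⟨Φ, hΦ, hΦ0, hΦd, hΦg⟩ := exists_smooth_flow (W := fun q : ℝ × E => ((1 : ℝ), V q))
    (contDiff_const.prodMk hV) (exists_integralCurve_of_bounded_on_slabs hV hb)
  have hfst : ∀ t p, (Φ t p).1 = p.1 + t := by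
    intro t p
    have hd : ∀ t, HasDerivAt (fun t => (Φ t p).1 - t) 0 t := fun t =>
      ((hasFDerivAt_fst.comp_hasDerivAt t (hΦd t p)).sub (hasDerivAt_id t)).congr_deriv (by simp)
    have := is_const_of_deriv_eq_zero (fun t => (hd t).differentiableAt)
      (fun t => (hd t).deriv) t 0
    simp only [hΦ0] at this
    linarith
  set σ : ℝ × E → ℝ := fun p => σ₀ (Φ (-p.1) p).2
  have hσ : ContDiff ℝ (⊤ : ℕ∞) σ := by
    refine hσ₀.comp (contDiff_snd.comp (hΦ.comp (contDiff_fst.neg.prodMk contDiff_id)))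
  refine ⟨σ, hσ, fun x => by simp [σ, hΦ0], fun p => ?_⟩
  have h1 : HasDerivAt (fun s => σ (Φ s p)) (fderiv ℝ σ p (1, V p)) 0 := by
    have := (hσ.differentiable (by simp) (Φ 0 p)).hasFDerivAt.comp_hasDerivAt (0:ℝ) (hΦd 0 p)
    rwa [hΦ0] at this
  have h2 : (fun s => σ (Φ s p)) = fun _ => σ p := by
    funext s
    simp only [σ, hfst, hΦg]
    congr 3
    ring
  rw [h2] at h1
  exact h1.unique (hasDerivAt_const _ _)

lemma norm_le_of_barrier_right {G : Type} [NormedAddCommGroup G] [NormedSpace ℝ G]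
    {u u' : ℝ → G} (hu : ∀ s, HasDerivAt u (u' s) s) {B B' : ℝ → ℝ}
    (hB : ∀ s, HasDerivAt B (B' s) s) (h0 : ‖u 0‖ ≤ B 0) {T : ℝ}
    (h : ∀ s, 0 ≤ s → s < T → ‖u s‖ = B s → ‖u' s‖ < B' s) {s : ℝ} (hs : 0 ≤ s) (hsT : s ≤ T) :
    ‖u s‖ ≤ B s :=
  image_norm_le_of_norm_deriv_right_lt_deriv_boundary (a := 0) (b := T) (f' := u') (B' := B')
    (fun s _ => (hu s).continuousAt.continuousWithinAt) (fun s _ => (hu s).hasDerivWithinAt) h0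
    hB (fun s hs he => h s hs.1 hs.2 he) ⟨hs, hsT⟩

lemma norm_le_of_barrier {G : Type} [NormedAddCommGroup G] [NormedSpace ℝ G]
    {u u' : ℝ → G} (hu : ∀ s, HasDerivAt u (u' s) s) {B B' : ℝ → ℝ}
    (hB : ∀ s, HasDerivAt B (B' s) s) (h0 : ‖u 0‖ ≤ B 0) {T : ℝ}
    (h : ∀ s, |s| < T → ‖u s‖ = B |s| → ‖u' s‖ < B' |s|) {s : ℝ} (hsT : |s| ≤ T) :
    ‖u s‖ ≤ B |s| := by
  rcases le_total 0 s with hs | hs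
  · rw [abs_of_nonneg hs] at *
    refine norm_le_of_barrier_right hu hB h0 (fun r hr hrT he => ?_) hs hsT
    have := h r (by rwa [abs_of_nonneg hr]) (by rwa [abs_of_nonneg hr])
    rwa [abs_of_nonneg hr] at this
  · rw [abs_of_nonpos hs] at *
    have := norm_le_of_barrier_right (u := fun s => u (-s)) (u' := fun s => -u' (-s))
      (fun r => ((hu (-r)).scomp r (hasDerivAt_neg r)).congr_deriv (by simp)) hB (by simpa using h0)
      (fun r hr hrT he => ?_) (neg_nonneg.2 hs) hsT
    · simpa using this
    · have := h (-r) (by rwa [abs_neg, abs_of_nonneg hr]) (by rwa [abs_neg, abs_of_nonneg hr])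
      rwa [abs_neg, abs_of_nonneg hr, ← norm_neg] at this

/-- Comparison principle for transported quantities. -/
lemma transport_comparison {E G : Type} [NormedAddCommGroup E] [NormedSpace ℝ E]
    [NormedAddCommGroup G] [NormedSpace ℝ G] {V : ℝ × E → E} (hV : HasTrajectories V)
    {w : ℝ × E → G} (hw : Differentiable ℝ w) {B B' : ℝ → ℝ}
    (hB : ∀ s, HasDerivAt B (B' s) s) (h0 : ∀ x, ‖w (0, x)‖ ≤ B 0) {T : ℝ}
    (h : ∀ p : ℝ × E, |p.1| < T → ‖w p‖ = B |p.1| → ‖fderiv ℝ w p (1, V p)‖ < B' |p.1|)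
    {p : ℝ × E} (hp : |p.1| ≤ T) : ‖w p‖ ≤ B |p.1| := by
  obtain ⟨X, hXp, hX⟩ := hV p
  have := norm_le_of_barrier (fun s => hasDerivAt_along hw hX s) hB (h0 _)
    (fun s hs he => h (s, X s) hs he) hp
  rwa [hXp] at this

/-- Finite propagation speed for transported functions. -/
lemma transport_support {E G : Type} [NormedAddCommGroup E] [NormedSpace ℝ E]
    [NormedAddCommGroup G] [NormedSpace ℝ G] {V : ℝ × E → E} (hV : HasTrajectories V)
    {w : ℝ × E → G} (hw : Differentiable ℝ w) (hwV : ∀ p, fderiv ℝ w p (1, V p) = 0)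
    {R R' : ℝ → ℝ} (hR : ∀ s, HasDerivAt R (R' s) s)
    (h0 : ∀ x, R 0 < ‖x‖ → w (0, x) = 0) {T : ℝ}
    (h : ∀ p : ℝ × E, |p.1| < T → ‖V p‖ < R' |p.1|)
    {p : ℝ × E} (hp : |p.1| ≤ T) (hpR : R |p.1| < ‖p.2‖) : w p = 0 := by
  obtain ⟨X, hXp, hX⟩ := hV p
  have hc := const_along hw hwV hX p.1 0
  rw [hXp] at hc
  by_contra hne
  have hX0 : ‖X 0‖ ≤ R 0 := by
    by_contra! hlt
    exact hne (hc.trans (h0 _ hlt))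
  have := norm_le_of_barrier hX hR hX0 (fun s hs _ => h (s, X s) hs) hp
  rw [hXp] at this
  linarith

lemma transport_eq_initial {E G : Type} [NormedAddCommGroup E] [NormedSpace ℝ E]
    [NormedAddCommGroup G] [NormedSpace ℝ G] {V : ℝ × E → E} (hV : HasTrajectories V)
    {w : ℝ × E → G} (hw : Differentiable ℝ w) (hwV : ∀ p, fderiv ℝ w p (1, V p) = 0)
    (p : ℝ × E) : ∃ a, w p = w (0, a) := by
  obtain ⟨X, hXp, hX⟩ := hV p
  exact ⟨X 0, by rw [← const_along hw hwV hX p.1 0, hXp]⟩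

/-- The Euclidean plane. -/
abbrev Plane := EuclideanSpace ℝ (Fin 2)

lemma finrank_plane : Module.finrank ℝ Plane = 2 := by simp

/-- The area of the unit disc. -/
def discArea : ℝ := (volume : Measure Plane).real (Metric.ball 0 1)

lemma discArea_nonneg : 0 ≤ discArea := measureReal_nonneg

lemma integrableOn_radial {g : ℝ → ℝ} (hg : Continuous g) (R : ℝ) :
    IntegrableOn (fun z : Plane => g ‖z‖ / ‖z‖) (Metric.ball 0 R) := by
  rw [integrableOn_fun_norm_addHaar (volume : Measure Plane) (f := fun r => g r / r),
    finrank_plane]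
  refine IntegrableOn.congr_fun (f := g) ?_ (fun r hr => ?_) measurableSet_Ioo
  · exact (hg.integrableOn_Icc (a := 0) (b := R)).mono_set Ioo_subset_Icc_self
  · have : r ≠ 0 := hr.1.ne'
    simp; field_simp

lemma integral_radial (g : ℝ → ℝ) {R : ℝ} (hR : 0 ≤ R) :
    ∫ z in Metric.ball (0 : Plane) R, g ‖z‖ / ‖z‖ = 2 * discArea * ∫ r in (0:ℝ)..R, g r := by
  rw [← integral_indicator Metric.isOpen_ball.measurableSet]
  have h1 : (Metric.ball (0 : Plane) R).indicator (fun z : Plane => g ‖z‖ / ‖z‖)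
      = fun z => (Iio R).indicator (fun r => g r / r) ‖z‖ := by
    funext z
    simp [indicator]
  rw [h1, integral_fun_norm_addHaar (volume : Measure Plane), finrank_plane]
  have h2 : ∫ y in Ioi (0:ℝ), y ^ (2 - 1) • (Iio R).indicator (fun r => g r / r) y
      = ∫ y in Ioi (0:ℝ), (Iio R).indicator g y := by
    refine setIntegral_congr_fun measurableSet_Ioi fun y (hy : 0 < y) => ?_
    by_cases h : y < R
    · simp [h]; field_simp
    · simp [h]
  rw [h2, setIntegral_indicator measurableSet_Iio, Ioi_inter_Iio,
    intervalIntegral.integral_of_le hR, integral_Ioc_eq_integral_Ioo]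
  simp [discArea]
  ring

/-- Convolution of a bounded compactly supported function with a kernel having a radial
majorant. -/
lemma norm_conv_le {G : Type} [NormedAddCommGroup G] [NormedSpace ℝ G] {K : Plane → G}
    {g : ℝ → ℝ} (hg : Continuous g) (hg0 : ∀ r, 0 ≤ g r) (hK : ∀ z ≠ 0, ‖K z‖ ≤ g ‖z‖ / ‖z‖)
    {R c : ℝ} (hR : 0 ≤ R) (hc : ∀ z : Plane, R ≤ ‖z‖ → g ‖z‖ / ‖z‖ ≤ c)
    {f : Plane → ℝ} {M : ℝ} (hM : 0 ≤ M) (hfM : ∀ x, |f x| ≤ M)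
    (hfR : ∀ x, R < ‖x‖ → f x = 0) (hc0 : 0 ≤ c) (x : Plane) :
    ‖∫ z, f (x - z) • K z‖
      ≤ M * (2 * discArea * (∫ r in (0:ℝ)..R, g r) + c * (R ^ 2 * discArea)) := by
  set F : Plane → ℝ := fun z => M * ((Metric.ball 0 R).indicator (fun z => g ‖z‖ / ‖z‖) z
    + (Metric.closedBall x R).indicator (fun _ => c) z)
  have hi1 : Integrable ((Metric.ball 0 R).indicator (fun z : Plane => g ‖z‖ / ‖z‖)) :=
    (integrableOn_radial hg R).integrable_indicator Metric.isOpen_ball.measurableSet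
  have hi2 : Integrable ((Metric.closedBall x R).indicator (fun _ : Plane => c)) :=
    (integrableOn_const measure_closedBall_lt_top.ne).integrable_indicator
      Metric.isClosed_closedBall.measurableSet
  have hF : Integrable F := (hi1.add hi2).const_mul M
  have hFI : ∫ z, F z
      = M * (2 * discArea * (∫ r in (0:ℝ)..R, g r) + c * (R ^ 2 * discArea)) := by
    rw [integral_const_mul, integral_add hi1 hi2,
      integral_indicator Metric.isOpen_ball.measurableSet,
      integral_indicator Metric.isClosed_closedBall.measurableSet, integral_radial g hR,
      setIntegral_const, Measure.addHaar_real_closedBall _ _ hR, finrank_plane]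
    simp only [smul_eq_mul, discArea]
    ring
  rw [← hFI]
  refine norm_integral_le_of_norm_le hF ?_
  filter_upwards [compl_mem_ae_iff.2 (measure_singleton (μ := volume) (0 : Plane))] with z hz0
  rw [norm_smul, Real.norm_eq_abs]
  have hn : ∀ z : Plane, 0 ≤ g ‖z‖ / ‖z‖ := fun z => div_nonneg (hg0 _) (norm_nonneg _)
  by_cases h : ‖x - z‖ ≤ R
  · refine mul_le_mul (hfM _) ?_ (norm_nonneg _) hM
    by_cases hz : ‖z‖ < R
    · have h1 : (Metric.ball 0 R).indicator (fun z => g ‖z‖ / ‖z‖) z = g ‖z‖ / ‖z‖ :=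
        indicator_of_mem (by simpa using hz) _
      have h2 : 0 ≤ (Metric.closedBall x R).indicator (fun _ => c) z :=
        indicator_nonneg (fun _ _ => hc0) _
      have := hK z hz0
      rw [h1]; linarith
    · have h1 : (Metric.closedBall x R).indicator (fun _ => c) z = c :=
        indicator_of_mem (by rwa [Metric.mem_closedBall, dist_comm, dist_eq_norm]) _
      have h2 : 0 ≤ (Metric.ball 0 R).indicator (fun z : Plane => g ‖z‖ / ‖z‖) z :=
        indicator_nonneg (fun _ _ => hn _) _
      have := hK z hz0
      have := hc z (not_lt.1 hz)
      rw [h1]; linarith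
  · rw [hfR _ (not_le.1 h), abs_zero, zero_mul]
    exact mul_nonneg hM (add_nonneg (indicator_nonneg (fun _ _ => hn _) _)
      (indicator_nonneg (fun _ _ => hc0) _))

/-- The Biot–Savart kernel. -/
def bsKernel (z : Plane) : Plane := (1 / (2 * Real.pi) * (‖z‖ ^ 2)⁻¹) • perp z

/-- Rotation by a right angle, as a continuous linear map. -/
def perpL : Plane →L[ℝ] Plane :=
  LinearMap.toContinuousLinearMap
    { toFun := perp
      map_add' := fun x y => by ext i; fin_cases i <;> simp [perp]; ring
      map_smul' := fun c x => by ext i; fin_cases i <;> simp [perp] }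

lemma norm_perp (z : Plane) : ‖perp z‖ = ‖z‖ := by
  simp [EuclideanSpace.norm_eq, perp, Fin.sum_univ_two, add_comm]

lemma norm_bsKernel (z : Plane) : ‖bsKernel z‖ = 1 / (2 * Real.pi) / ‖z‖ := by
  have := Real.pi_pos
  rw [bsKernel, norm_smul, norm_perp, Real.norm_of_nonneg (by positivity)]
  rcases eq_or_ne ‖z‖ 0 with h | h
  · simp [h]
  · field_simp

lemma measurable_bsKernel : Measurable bsKernel := by
  have : Measurable (fun z : Plane => perpL z) := perpL.continuous.measurable
  unfold bsKernel
  exact (show Measurable fun z : Plane => 1 / (2 * Real.pi) * (‖z‖ ^ 2)⁻¹ from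
    ((measurable_norm.pow_const 2).inv).const_mul _).smul this

lemma locallyIntegrable_bsKernel : LocallyIntegrable bsKernel := by
  refine locallyIntegrable_of_norm_le_rpow (C := 1 / (2 * Real.pi)) (α := 1)
    (by simp) (by simp) (Filter.Eventually.of_forall fun z => ?_)
    measurable_bsKernel.aestronglyMeasurable
  rw [norm_bsKernel, Real.rpow_neg_one, div_eq_mul_inv]

lemma biotSavart_eq (ω : Plane → ℝ) (x : Plane) :
    biotSavart ω x = ∫ z, ω (x - z) • bsKernel z := by
  rw [biotSavart, ← integral_smul, ← integral_sub_left_eq_self _ _ x]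
  refine integral_congr_ae (Filter.Eventually.of_forall fun z => ?_)
  have hz : x - (x - z) = z := by abel
  simp only [bsKernel, hz, smul_smul]
  congr 1
  ring

/-- The function `f` on space-time vanishes outside the ball of radius `R T` in each slab. -/
def SuppIn (R : ℝ → ℝ) (f : ℝ × Plane → ℝ) : Prop :=
  ∀ T, ∀ p : ℝ × Plane, |p.1| < T → R T < ‖p.2‖ → f p = 0

lemma SuppIn.fderiv_apply {R : ℝ → ℝ} {f : ℝ × Plane → ℝ} (hf : SuppIn R f) (v : ℝ × Plane) :
    SuppIn R fun p => fderiv ℝ f p v := by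
  intro T p hp hpR
  have ho : IsOpen {q : ℝ × Plane | |q.1| < T ∧ R T < ‖q.2‖} :=
    (isOpen_lt (continuous_fst.abs) continuous_const).inter
      (isOpen_lt continuous_const continuous_snd.norm)
  have : f =ᶠ[nhds p] fun _ => 0 :=
    Filter.mem_of_superset (ho.mem_nhds ⟨hp, hpR⟩) fun q hq => hf T q hq.1 hq.2
  simp [this.fderiv_eq]

/-- Spatial convolution with the kernel `k`. -/
def conv (k : Plane → ℝ) (f : ℝ × Plane → ℝ) (p : ℝ × Plane) : ℝ :=
  ∫ z, k z * f (p.1, p.2 - z)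

lemma contDiff_conv {k : Plane → ℝ} (hk : LocallyIntegrable k) {R : ℝ → ℝ}
    {f : ℝ × Plane → ℝ} (hf : ContDiff ℝ (⊤ : ℕ∞) f) (hfR : SuppIn R f) :
    ContDiff ℝ (⊤ : ℕ∞) (conv k f) := by
  rw [contDiff_iff_contDiffAt]
  intro p
  have ho : IsOpen {t : ℝ | |t| < |p.1| + 1} := isOpen_lt (by fun_prop) (by fun_prop)
  have := contDiffOn_convolution_right_with_param (𝕜 := ℝ) (n := (⊤ : ℕ∞)) (μ := volume)
    (ContinuousLinearMap.mul ℝ ℝ) (g := fun t x => f (t, x)) ho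
    (isCompact_closedBall (0 : Plane) (R (|p.1| + 1)))
    (fun t x ht hx => hfR _ (t, x) ht (by simpa using hx)) hk (by exact hf.contDiffOn)
  exact this.contDiffAt ((ho.prod isOpen_univ).mem_nhds ⟨by simp, trivial⟩)

lemma fderiv_conv {k : Plane → ℝ} (hk : LocallyIntegrable k) {R : ℝ → ℝ}
    {f : ℝ × Plane → ℝ} (hf : ContDiff ℝ (⊤ : ℕ∞) f) (hfR : SuppIn R f) (p v : ℝ × Plane) :
    fderiv ℝ (conv k f) p v = conv k (fun q => fderiv ℝ f q v) p := by
  have ho : IsOpen {t : ℝ | |t| < |p.1| + 1} := isOpen_lt (by fun_prop) (by fun_prop)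
  have := hasFDerivAt_convolution_right_with_param (𝕜 := ℝ) (μ := volume)
    (ContinuousLinearMap.mul ℝ ℝ) (g := fun t x => f (t, x)) ho
    (isCompact_closedBall (0 : Plane) (R (|p.1| + 1)))
    (fun t x ht hx => hfR _ (t, x) ht (by simpa using hx)) hk
    (by exact (hf.of_le (by exact_mod_cast le_top)).contDiffOn) p (by simp)
  rw [show fderiv ℝ (conv k f) p = _ from this.fderiv, convolution_precompR_apply _ hk]
  · rfl
  · refine HasCompactSupport.intro (isCompact_closedBall (0 : Plane) (R (|p.1| + 1)))
      fun x hx => ?_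
    refine ContinuousLinearMap.ext fun v => ?_
    exact hfR.fderiv_apply v (|p.1| + 1) (p.1, x) (by simp) (by simpa using hx)
  · have : Continuous (fderiv ℝ f) := hf.continuous_fderiv (by simp)
    exact this.comp (Continuous.prodMk_right p.1)

/-- The components of the Biot–Savart kernel. -/
def bsComp (l : Fin 2) (z : Plane) : ℝ := bsKernel z l

lemma locallyIntegrable_bsComp (l : Fin 2) : LocallyIntegrable (bsComp l) := by
  refine locallyIntegrable_bsKernel.mono ?_ (Filter.Eventually.of_forall fun z => ?_)
  · exact ((EuclideanSpace.proj (𝕜 := ℝ) l).continuous.measurable.comp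
      measurable_bsKernel).aestronglyMeasurable
  · exact PiLp.norm_apply_le _ _

lemma abs_bsComp_le (l : Fin 2) (z : Plane) : ‖bsComp l z‖ ≤ 1 / (2 * Real.pi) / ‖z‖ :=
  (PiLp.norm_apply_le _ _).trans (norm_bsKernel z).le

/-- The constant of the sup bound for the velocity. -/
def velConst : ℝ := 3 * discArea / (2 * Real.pi)

lemma velConst_nonneg : 0 ≤ velConst := by
  have := discArea_nonneg
  have := Real.pi_pos
  unfold velConst; positivity

lemma abs_conv_bsComp_le (l : Fin 2) {f : ℝ × Plane → ℝ} {R M : ℝ} (hR : 0 < R) (hM : 0 ≤ M)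
    (p : ℝ × Plane) (hfM : ∀ x, |f (p.1, x)| ≤ M) (hfR : ∀ x, R < ‖x‖ → f (p.1, x) = 0) :
    |conv (bsComp l) f p| ≤ velConst * (M * R) := by
  have hpi := Real.pi_pos
  have := norm_conv_le (K := bsComp l) (g := fun _ => 1 / (2 * Real.pi)) continuous_const
    (fun _ => by positivity) (fun z _ => abs_bsComp_le l z) hR.le (c := 1 / (2 * Real.pi) / R)
    (fun z hz => by gcongr) (f := fun x => f (p.1, x)) hM hfM hfR (by positivity) p.2
  simp only [smul_eq_mul, Real.norm_eq_abs] at this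
  rw [conv]
  simp_rw [mul_comm (bsComp l _)]
  refine this.trans (le_of_eq ?_)
  rw [intervalIntegral.integral_const, velConst]
  simp only [smul_eq_mul]
  field_simp
  ring

/-- The components of the rotation by a right angle. -/
def perpComp (l : Fin 2) : Plane →L[ℝ] ℝ := (EuclideanSpace.proj (𝕜 := ℝ) l).comp perpL

lemma abs_perpComp_le (l : Fin 2) (z : Plane) : |perpComp l z| ≤ ‖z‖ :=
  (PiLp.norm_apply_le (perp z) l).trans (norm_perp z).le

lemma bsComp_eq (l : Fin 2) (z : Plane) :
    bsComp l z = 1 / (2 * Real.pi) * (‖z‖ ^ 2)⁻¹ * perpComp l z := rfl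

/-- A regularization of the components of the Biot–Savart kernel. -/
def bsReg (δ : ℝ) (l : Fin 2) (z : Plane) : ℝ :=
  1 / (2 * Real.pi) * (‖z‖ ^ 2 + δ ^ 2)⁻¹ * perpComp l z

lemma contDiff_bsReg {δ : ℝ} (hδ : 0 < δ) (l : Fin 2) : ContDiff ℝ 1 (bsReg δ l) := by
  unfold bsReg
  refine (contDiff_const.mul (ContDiff.inv ?_ fun z => by positivity)).mul
    (perpComp l).contDiff
  exact (contDiff_norm_sq ℝ).add contDiff_const

lemma fderiv_bsReg {δ : ℝ} (hδ : 0 < δ) (l : Fin 2) (z u : Plane) :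
    fderiv ℝ (bsReg δ l) z u = 1 / (2 * Real.pi) * ((‖z‖ ^ 2 + δ ^ 2)⁻¹ * perpComp l u
      - 2 * inner ℝ z u / (‖z‖ ^ 2 + δ ^ 2) ^ 2 * perpComp l z) := by
  have hs : ‖z‖ ^ 2 + δ ^ 2 ≠ 0 := by positivity
  have h1 : HasFDerivAt (fun z : Plane => ‖z‖ ^ 2 + δ ^ 2) (2 • innerSL ℝ z) z :=
    (hasStrictFDerivAt_norm_sq z).hasFDerivAt.add_const _
  have h2 := (((hasDerivAt_inv hs).comp_hasFDerivAt z h1).const_mul (1 / (2 * Real.pi))).mul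
    (perpComp l).hasFDerivAt
  have h3 : HasFDerivAt (bsReg δ l) _ z := h2
  rw [h3.fderiv]
  simp
  field_simp
  ring

lemma sq_half_le (r δ : ℝ) : (r + δ) ^ 2 / 2 ≤ r ^ 2 + δ ^ 2 := by nlinarith [sq_nonneg (r - δ)]

lemma abs_fderiv_bsReg_le {δ : ℝ} (hδ : 0 < δ) (l : Fin 2) {z u : Plane} (hz : z ≠ 0)
    (hu : ‖u‖ ≤ 1) :
    |fderiv ℝ (bsReg δ l) z u| ≤ 3 / Real.pi * (|‖z‖| + δ)⁻¹ / ‖z‖ := by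
  have hpi := Real.pi_pos
  have hz' : 0 < ‖z‖ := norm_pos_iff.2 hz
  set s := ‖z‖ ^ 2 + δ ^ 2 with hs
  have hs0 : 0 < s := by positivity
  have hs1 : (‖z‖ + δ) * ‖z‖ / 2 ≤ s := by nlinarith [sq_half_le ‖z‖ δ]
  have hin : |inner ℝ z u| ≤ ‖z‖ := by
    have := abs_real_inner_le_norm z u
    nlinarith
  have hpu : |perpComp l u| ≤ 1 := (abs_perpComp_le l u).trans hu
  have hpz := abs_perpComp_le l z
  have h2 : |2 * inner ℝ z u / s ^ 2 * perpComp l z| ≤ 2 * s⁻¹ := by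
    rw [abs_mul, abs_div, abs_mul, abs_two, abs_of_pos (by positivity : 0 < s ^ 2)]
    calc 2 * |inner ℝ z u| / s ^ 2 * |perpComp l z| ≤ 2 * ‖z‖ / s ^ 2 * ‖z‖ := by gcongr
      _ = 2 * (‖z‖ ^ 2 / s ^ 2) := by ring
      _ ≤ 2 * (s / s ^ 2) := by gcongr; nlinarith [sq_nonneg δ]
      _ = 2 * s⁻¹ := by field_simp
  have h1 : |s⁻¹ * perpComp l u| ≤ s⁻¹ := by
    rw [abs_mul, abs_of_pos (by positivity : 0 < s⁻¹)]
    exact mul_le_of_le_one_right (by positivity) hpu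
  rw [fderiv_bsReg hδ, abs_mul, abs_of_pos (by positivity : 0 < 1 / (2 * Real.pi)),
    abs_of_pos hz']
  calc 1 / (2 * Real.pi) * |s⁻¹ * perpComp l u - 2 * inner ℝ z u / s ^ 2 * perpComp l z|
      ≤ 1 / (2 * Real.pi) * (3 * s⁻¹) := by
        gcongr
        exact (abs_sub _ _).trans (by linarith)
    _ ≤ 1 / (2 * Real.pi) * (3 * ((‖z‖ + δ) * ‖z‖ / 2)⁻¹) := by gcongr
    _ = 3 / Real.pi * (‖z‖ + δ)⁻¹ / ‖z‖ := by field_simp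

lemma abs_bsComp_sub_bsReg_le {δ : ℝ} (hδ : 0 < δ) (l : Fin 2) {z : Plane} (hz : z ≠ 0) :
    |bsComp l z - bsReg δ l z| ≤ δ / Real.pi * (|‖z‖| + δ)⁻¹ / ‖z‖ := by
  have hpi := Real.pi_pos
  have hz' : 0 < ‖z‖ := norm_pos_iff.2 hz
  have hs1 : (‖z‖ + δ) * δ / 2 ≤ ‖z‖ ^ 2 + δ ^ 2 := by nlinarith [sq_half_le ‖z‖ δ]
  have he : bsComp l z - bsReg δ l z
      = 1 / (2 * Real.pi) * (δ ^ 2 / (‖z‖ ^ 2 * (‖z‖ ^ 2 + δ ^ 2))) * perpComp l z := by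
    rw [bsComp_eq, bsReg]
    have : ‖z‖ ^ 2 + δ ^ 2 ≠ 0 := by positivity
    field_simp
    ring
  rw [he, abs_mul, abs_of_pos (by positivity :
    0 < 1 / (2 * Real.pi) * (δ ^ 2 / (‖z‖ ^ 2 * (‖z‖ ^ 2 + δ ^ 2)))), abs_of_pos hz']
  calc 1 / (2 * Real.pi) * (δ ^ 2 / (‖z‖ ^ 2 * (‖z‖ ^ 2 + δ ^ 2))) * |perpComp l z|
      ≤ 1 / (2 * Real.pi) * (δ ^ 2 / (‖z‖ ^ 2 * ((‖z‖ + δ) * δ / 2))) * ‖z‖ := by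
        gcongr
        exact abs_perpComp_le l z
    _ = δ / Real.pi * (‖z‖ + δ)⁻¹ / ‖z‖ := by field_simp

lemma integral_inv_abs_add {R δ : ℝ} (hR : 0 ≤ R) (hδ : 0 < δ) :
    ∫ r in (0:ℝ)..R, (|r| + δ)⁻¹ = Real.log ((R + δ) / δ) := by
  have h : ∀ r ∈ uIcc 0 R, 0 ≤ r := fun r hr => by
    rw [uIcc_of_le hR] at hr; exact hr.1
  rw [intervalIntegral.integral_eq_sub_of_hasDerivAt (f := fun r => Real.log (r + δ))]
  · rw [Real.log_div (by positivity) hδ.ne', zero_add]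
  · intro r hr
    have hr0 := h r hr
    rw [abs_of_nonneg hr0]
    simpa using ((hasDerivAt_id r).add_const δ).log (ne_of_gt (add_pos_of_nonneg_of_pos hr0 hδ))
  · refine Continuous.intervalIntegrable ?_ _ _
    exact (continuous_abs.add continuous_const).inv₀ fun r =>
      (add_pos_of_nonneg_of_pos (abs_nonneg r) hδ).ne'

/-- The logarithmic bound for the gradient of the velocity. -/
lemma abs_integral_bsComp_fderiv_le (l : Fin 2) {φ : Plane → ℝ} (hφ : ContDiff ℝ 1 φ)
    {R M a : ℝ} (hR : 1 ≤ R) (hM : 0 ≤ M) (ha : 0 ≤ a) {u : Plane} (hu : ‖u‖ ≤ 1)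
    (hφM : ∀ x, |φ x| ≤ M) (hφa : ∀ x, |fderiv ℝ φ x u| ≤ a) (hφR : ∀ x, R < ‖x‖ → φ x = 0)
    (x : Plane) :
    |∫ z, bsComp l z * fderiv ℝ φ (x - z) u| ≤
      discArea / Real.pi * (1 + 3 * M) * (2 * R + R ^ 2 + 2) * (1 + Real.log (1 + a)) := by
  have hpi := Real.pi_pos
  have hA := discArea_nonneg
  have hR0 : 0 < R := by linarith
  set δ : ℝ := (1 + a)⁻¹ with hδd
  have hδ : 0 < δ := by positivity
  have hδ1 : δ ≤ 1 := inv_le_one_of_one_le₀ (by linarith)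
  have haδ : a * δ ≤ 1 := by
    rw [hδd, ← div_eq_mul_inv, div_le_one (by linarith)]; linarith
  have hl0 : 0 ≤ Real.log (1 + a) := Real.log_nonneg (by linarith)
  have hLg : Real.log ((R + δ) / δ) ≤ R + Real.log (1 + a) := by
    rw [hδd, div_inv_eq_mul, Real.log_mul (by positivity) (by positivity)]
    have := Real.log_le_sub_one_of_pos (x := R + (1 + a)⁻¹) (by positivity)
    linarith
  have hφs : HasCompactSupport φ :=
    HasCompactSupport.intro (isCompact_closedBall (0 : Plane) R) fun x hx =>
      hφR x (by simpa using hx)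
  have hφ'R : ∀ x, R < ‖x‖ → fderiv ℝ φ x u = 0 := fun x hx => by
    have : φ =ᶠ[nhds x] fun _ => 0 := Filter.mem_of_superset
      ((isOpen_lt continuous_const continuous_norm).mem_nhds hx) fun y hy => hφR y hy
    simp [this.fderiv_eq]
  have hcφ' : Continuous fun z => fderiv ℝ φ (x - z) u :=
    ((hφ.continuous_fderiv (by simp)).comp (continuous_const.sub continuous_id)).clm_apply
      continuous_const
  have hsub : HasCompactSupport fun z => φ (x - z) :=
    hφs.comp_homeomorph (Homeomorph.subLeft x)
  have hsub' : HasCompactSupport fun z => fderiv ℝ φ (x - z) u :=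
    (hφs.fderiv_apply (𝕜 := ℝ) u).comp_homeomorph (Homeomorph.subLeft x)
  have hcr := (contDiff_bsReg hδ l).continuous
  have hcr' : Continuous fun z => fderiv ℝ (bsReg δ l) z u :=
    ((contDiff_bsReg hδ l).continuous_fderiv (by simp)).clm_apply continuous_const
  have hfd : ∀ z, fderiv ℝ (fun z => φ (x - z)) z u = - fderiv ℝ φ (x - z) u := fun z => by
    have h := ((hφ.differentiable (by simp)) (x - z)).hasFDerivAt.comp z
      ((hasFDerivAt_id z).const_sub x)
    rw [show fderiv ℝ (fun z => φ (x - z)) z = _ from h.fderiv]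
    simp
  have hparts : ∫ z, bsReg δ l z * fderiv ℝ φ (x - z) u
      = ∫ z, φ (x - z) • fderiv ℝ (bsReg δ l) z u := by
    have hcφ : Continuous fun z => φ (x - z) :=
      hφ.continuous.comp (continuous_const.sub continuous_id)
    have h1 := (hcr'.mul hcφ).integrable_of_hasCompactSupport (μ := volume) hsub.mul_left
    have h2 := (hcr.mul hcφ).integrable_of_hasCompactSupport (μ := volume) hsub.mul_left
    have h3 := ((hcr.mul hcφ').integrable_of_hasCompactSupport (μ := volume) hsub'.mul_left).neg
    have := integral_mul_fderiv_eq_neg_fderiv_mul_of_integrable (μ := volume) (v := u)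
      (f := bsReg δ l) (g := fun z => φ (x - z)) h1
      (h3.congr (Filter.Eventually.of_forall fun z => by simp [hfd])) h2
      (fun z _ => (contDiff_bsReg hδ l).differentiable (by simp) z)
      (fun z _ => ((hφ.differentiable (by simp)) (x - z)).comp z
        (differentiableAt_id.const_sub x))
    simp_rw [hfd, mul_neg, integral_neg, neg_inj] at this
    rw [this]
    simp_rw [smul_eq_mul, mul_comm]
  have hi1 : Integrable fun z => bsReg δ l z * fderiv ℝ φ (x - z) u :=
    (hcr.mul hcφ').integrable_of_hasCompactSupport hsub'.mul_left
  have hi2 : Integrable fun z => bsComp l z * fderiv ℝ φ (x - z) u :=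
    (locallyIntegrable_bsComp l).integrable_smul_right_of_hasCompactSupport hcφ' hsub'
  have hsplit : ∫ z, bsComp l z * fderiv ℝ φ (x - z) u
      = (∫ z, fderiv ℝ φ (x - z) u • (bsComp l z - bsReg δ l z))
        + ∫ z, φ (x - z) • fderiv ℝ (bsReg δ l) z u := by
    rw [← hparts, ← sub_eq_iff_eq_add, ← integral_sub hi2 hi1]
    congr 1 with z
    rw [smul_eq_mul]; ring
  have hcg : Continuous fun r : ℝ => (|r| + δ)⁻¹ :=
    (continuous_abs.add continuous_const).inv₀ fun r =>
      (add_pos_of_nonneg_of_pos (abs_nonneg r) hδ).ne'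
  have hgc : ∀ c : ℝ, 0 ≤ c → ∀ z : Plane, R ≤ ‖z‖ → c * (|‖z‖| + δ)⁻¹ / ‖z‖ ≤ c := by
    intro c hc z hz
    have h1 : 1 ≤ ‖z‖ := hR.trans hz
    rw [abs_norm, mul_div_assoc]
    refine mul_le_of_le_one_right hc ?_
    rw [div_le_one (by linarith)]
    exact (inv_le_one_of_one_le₀ (by linarith)).trans h1
  have hP1 := norm_conv_le (K := fun z => bsComp l z - bsReg δ l z)
    (g := fun r => δ / Real.pi * (|r| + δ)⁻¹) (continuous_const.mul hcg)
    (fun r => by positivity) (fun z hz => abs_bsComp_sub_bsReg_le hδ l hz) hR0.le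
    (hgc _ (by positivity)) (f := fun x => fderiv ℝ φ x u) ha hφa hφ'R (by positivity) x
  have hP2 := norm_conv_le (K := fun z => fderiv ℝ (bsReg δ l) z u)
    (g := fun r => 3 / Real.pi * (|r| + δ)⁻¹) (continuous_const.mul hcg)
    (fun r => by positivity) (fun z hz => abs_fderiv_bsReg_le hδ l hz hu) hR0.le
    (hgc _ (by positivity)) hM hφM hφR (by positivity) x
  rw [intervalIntegral.integral_const_mul, integral_inv_abs_add hR0.le hδ] at hP1 hP2
  set Lg := Real.log ((R + δ) / δ)
  have hLg0 : 0 ≤ Lg := Real.log_nonneg (by rw [le_div_iff₀ hδ]; linarith)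
  have hb1 : a * (2 * discArea * (δ / Real.pi * Lg) + δ / Real.pi * (R ^ 2 * discArea))
      ≤ discArea / Real.pi * (2 * Lg + R ^ 2) := by
    have : a * (2 * discArea * (δ / Real.pi * Lg) + δ / Real.pi * (R ^ 2 * discArea))
      = (a * δ) * (discArea / Real.pi * (2 * Lg + R ^ 2)) := by field_simp
    rw [this]
    exact mul_le_of_le_one_left (by positivity) haδ
  rw [hsplit]
  calc _ ≤ discArea / Real.pi * (2 * Lg + R ^ 2)
        + M * (2 * discArea * (3 / Real.pi * Lg) + 3 / Real.pi * (R ^ 2 * discArea)) :=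
        (abs_add_le _ _).trans (add_le_add (hP1.trans hb1) hP2)
    _ = discArea / Real.pi * (1 + 3 * M) * (2 * Lg + R ^ 2) := by field_simp
    _ ≤ discArea / Real.pi * (1 + 3 * M) * ((2 * R + R ^ 2 + 2) * (1 + Real.log (1 + a))) := by
        gcongr
        nlinarith [mul_nonneg (by positivity : 0 ≤ 2 * R + R ^ 2) hl0]
    _ = _ := by ring

/-- The time direction in space-time. -/
def timeDir : ℝ × Plane := (1, 0)

/-- The spatial coordinate directions in space-time. -/
def spaceDir (i : Fin 2) : ℝ × Plane := (0, EuclideanSpace.single i 1)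

/-- The directional derivative. -/
def dd (v : ℝ × Plane) (f : ℝ × Plane → ℝ) (p : ℝ × Plane) : ℝ := fderiv ℝ f p v

lemma ContDiff.dd {f : ℝ × Plane → ℝ} (hf : ContDiff ℝ (⊤ : ℕ∞) f) (v : ℝ × Plane) :
    ContDiff ℝ (⊤ : ℕ∞) (dd v f) :=
  (hf.fderiv_right (m := (⊤ : ℕ∞)) (by exact_mod_cast le_top)).clm_apply contDiff_const

lemma differentiable_of_smooth {f : ℝ × Plane → ℝ} (hf : ContDiff ℝ (⊤ : ℕ∞) f) :
    Differentiable ℝ f := hf.differentiable (by simp)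

lemma dd_add {f g : ℝ × Plane → ℝ} (hf : Differentiable ℝ f) (hg : Differentiable ℝ g)
    (v : ℝ × Plane) : dd v (fun p => f p + g p) = fun p => dd v f p + dd v g p := by
  funext p
  simp [dd, fderiv_fun_add (hf p) (hg p)]

lemma dd_sub {f g : ℝ × Plane → ℝ} (hf : Differentiable ℝ f) (hg : Differentiable ℝ g)
    (v : ℝ × Plane) : dd v (fun p => f p - g p) = fun p => dd v f p - dd v g p := by
  funext p
  simp [dd, fderiv_fun_sub (hf p) (hg p)]

lemma dd_neg (f : ℝ × Plane → ℝ) (v : ℝ × Plane) :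
    dd v (fun p => -f p) = fun p => -dd v f p := by
  funext p
  simp [dd, fderiv_fun_neg]

lemma dd_mul {f g : ℝ × Plane → ℝ} (hf : Differentiable ℝ f) (hg : Differentiable ℝ g)
    (v : ℝ × Plane) :
    dd v (fun p => f p * g p) = fun p => dd v f p * g p + f p * dd v g p := by
  funext p
  simp only [dd, fderiv_fun_mul (hf p) (hg p), add_apply,
    smul_apply, smul_eq_mul]
  ring

lemma dd_comm {f : ℝ × Plane → ℝ} (hf : ContDiff ℝ (⊤ : ℕ∞) f) (u v : ℝ × Plane) :
    dd u (dd v f) = dd v (dd u f) := by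
  funext p
  have hd : Differentiable ℝ (fderiv ℝ f) :=
    (hf.fderiv_right (m := (⊤ : ℕ∞)) (by exact_mod_cast le_top)).differentiable (by simp)
  have key : ∀ a b, dd a (dd b f) p = fderiv ℝ (fderiv ℝ f) p a b := fun a b => by
    have : HasFDerivAt (dd b f) _ p := (hd p).hasFDerivAt.clm_apply (hasFDerivAt_const b p)
    rw [dd, this.fderiv]
    simp
  rw [key, key]
  exact second_derivative_symmetric (fun y => (differentiable_of_smooth hf y).hasFDerivAt)
    (hd p).hasFDerivAt u v

/-- Point reflection in space. -/
def reflect (f : ℝ × Plane → ℝ) (p : ℝ × Plane) : ℝ := f (p.1, -p.2)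

lemma ContDiff.reflect {f : ℝ × Plane → ℝ} (hf : ContDiff ℝ (⊤ : ℕ∞) f) :
    ContDiff ℝ (⊤ : ℕ∞) (reflect f) :=
  hf.comp (contDiff_fst.prodMk contDiff_snd.neg)

lemma dd_reflect {f : ℝ × Plane → ℝ} (hf : Differentiable ℝ f) (v : ℝ × Plane) :
    dd v (reflect f) = reflect (dd (v.1, -v.2) f) := by
  funext p
  have : HasFDerivAt (reflect f) _ p := (hf (p.1, -p.2)).hasFDerivAt.comp p
    ((hasFDerivAt_fst (p := p)).prodMk (hasFDerivAt_snd (p := p)).neg)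
  rw [dd, this.fderiv]
  rfl

lemma SuppIn.reflect {R : ℝ → ℝ} {f : ℝ × Plane → ℝ} (hf : SuppIn R f) :
    SuppIn R (reflect f) := fun T p hp hpR => hf T (p.1, -p.2) hp (by simpa using hpR)

lemma SuppIn.dd {R : ℝ → ℝ} {f : ℝ × Plane → ℝ} (hf : SuppIn R f) (v : ℝ × Plane) :
    SuppIn R (dd v f) := hf.fderiv_apply v

/-- The components of the velocity field generated by the reflection of `f`. -/
def vel (l : Fin 2) (f : ℝ × Plane → ℝ) : ℝ × Plane → ℝ := conv (bsComp l) (reflect f)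

lemma contDiff_vel (l : Fin 2) {R : ℝ → ℝ} {f : ℝ × Plane → ℝ}
    (hf : ContDiff ℝ (⊤ : ℕ∞) f) (hfR : SuppIn R f) : ContDiff ℝ (⊤ : ℕ∞) (vel l f) :=
  contDiff_conv (locallyIntegrable_bsComp l) hf.reflect hfR.reflect

lemma dd_vel (l : Fin 2) {R : ℝ → ℝ} {f : ℝ × Plane → ℝ}
    (hf : ContDiff ℝ (⊤ : ℕ∞) f) (hfR : SuppIn R f) (v : ℝ × Plane) :
    dd v (vel l f) = vel l (dd (v.1, -v.2) f) := by
  funext p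
  simp only [vel]
  rw [← dd_reflect (differentiable_of_smooth hf)]
  exact fderiv_conv (locallyIntegrable_bsComp l) hf.reflect hfR.reflect p v

lemma dd_neg_dir (v : ℝ × Plane) (f : ℝ × Plane → ℝ) : dd (-v) f = fun p => -dd v f p := by
  funext p; simp [dd]

lemma vel_neg (l : Fin 2) (f : ℝ × Plane → ℝ) :
    vel l (fun p => -f p) = fun p => -vel l f p := by
  funext p
  simp [vel, conv, _root_.reflect, integral_neg]

lemma dd_timeDir_vel (l : Fin 2) {R : ℝ → ℝ} {f : ℝ × Plane → ℝ}
    (hf : ContDiff ℝ (⊤ : ℕ∞) f) (hfR : SuppIn R f) :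
    dd timeDir (vel l f) = vel l (dd timeDir f) := by
  rw [dd_vel l hf hfR]; simp [timeDir]

lemma dd_spaceDir_vel (l : Fin 2) {R : ℝ → ℝ} {f : ℝ × Plane → ℝ}
    (hf : ContDiff ℝ (⊤ : ℕ∞) f) (hfR : SuppIn R f) (i : Fin 2) :
    dd (spaceDir i) (vel l f) = fun p => -vel l (dd (spaceDir i) f) p := by
  rw [dd_vel l hf hfR, ← vel_neg, ← dd_neg_dir]
  simp [spaceDir]

lemma abs_vel_le (l : Fin 2) {f : ℝ × Plane → ℝ} {R M : ℝ} (hR : 0 < R) (hM : 0 ≤ M)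
    (p : ℝ × Plane) (hfM : ∀ x, |f (p.1, x)| ≤ M) (hfR : ∀ x, R < ‖x‖ → f (p.1, x) = 0) :
    |vel l f p| ≤ velConst * (M * R) :=
  abs_conv_bsComp_le l hR hM p (fun x => hfM (-x)) fun x hx => hfR (-x) (by simpa using hx)

/-- The velocity field generated by the reflection of `f`. -/
def velField (f : ℝ × Plane → ℝ) (p : ℝ × Plane) : Plane :=
  (WithLp.equiv 2 (Fin 2 → ℝ)).symm fun l => vel l f p

@[simp] lemma velField_apply (f : ℝ × Plane → ℝ) (p : ℝ × Plane) (l : Fin 2) :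
    velField f p l = vel l f p := rfl

lemma contDiff_velField {R : ℝ → ℝ} {f : ℝ × Plane → ℝ}
    (hf : ContDiff ℝ (⊤ : ℕ∞) f) (hfR : SuppIn R f) : ContDiff ℝ (⊤ : ℕ∞) (velField f) := by
  rw [contDiff_euclidean]
  exact fun l => contDiff_vel l hf hfR

lemma norm_velField_le {f : ℝ × Plane → ℝ} {R M : ℝ} (hR : 0 < R) (hM : 0 ≤ M)
    (p : ℝ × Plane) (hfM : ∀ x, |f (p.1, x)| ≤ M) (hfR : ∀ x, R < ‖x‖ → f (p.1, x) = 0) :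
    ‖velField f p‖ ≤ 2 * velConst * (M * R) := by
  have h := fun l => abs_vel_le l hR hM p hfM hfR
  have hC : 0 ≤ velConst * (M * R) := (abs_nonneg _).trans (h 0)
  rw [EuclideanSpace.norm_eq, Fin.sum_univ_two]
  refine Real.sqrt_le_iff.2 ⟨by linarith, ?_⟩
  simp only [velField_apply, Real.norm_eq_abs]
  nlinarith [h 0, h 1, abs_nonneg (vel 0 f p), abs_nonneg (vel 1 f p)]

lemma fderiv_apply_one (f : ℝ × Plane → ℝ) (p : ℝ × Plane) (V : Plane) :
    fderiv ℝ f p (1, V) = dd timeDir f p + ∑ l, V l * dd (spaceDir l) f p := by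
  have : ((1 : ℝ), V) = timeDir + ∑ l, V l • spaceDir l := by
    refine Prod.ext ?_ ?_
    · simp [timeDir, spaceDir]
    · ext i
      fin_cases i <;> simp [timeDir, spaceDir, Fin.sum_univ_two]
  rw [this]
  simp [dd]

lemma velField_eq_biotSavart (f : ℝ × Plane → ℝ) (p : ℝ × Plane)
    (hi : Integrable fun z => f (p.1, -(p.2 - z)) • bsKernel z) :
    velField f p = biotSavart (fun x => f (p.1, -x)) p.2 := by
  rw [biotSavart_eq]
  ext l
  rw [velField_apply, vel, conv]
  have := (EuclideanSpace.proj (𝕜 := ℝ) l).integral_comp_comm hi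
  simp only [PiLp.proj_apply, PiLp.smul_apply, smul_eq_mul] at this
  rw [← this]
  congr 1 with z
  rw [mul_comm]; rfl

/-- The radius at time `T` of the support of data of radius `r` bounded by `M`. -/
def growRadius (M r T : ℝ) : ℝ := r * Real.exp ((2 * velConst * M + 1) * T)

lemma growRadius_pos {M r : ℝ} (hr : 1 ≤ r) (T : ℝ) : 0 < growRadius M r T := by
  unfold growRadius; positivity

lemma growRadius_mono {M r : ℝ} (hM : 0 ≤ M) (hr : 1 ≤ r) : Monotone (growRadius M r) := by
  intro s t h
  have := velConst_nonneg
  unfold growRadius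
  gcongr

lemma one_le_growRadius {M r : ℝ} (hM : 0 ≤ M) (hr : 1 ≤ r) {T : ℝ} (hT : 0 ≤ T) :
    1 ≤ growRadius M r T := by
  have h := growRadius_mono hM hr hT
  have : growRadius M r 0 = r := by simp [growRadius]
  linarith

lemma hasDerivAt_growRadius (M r s : ℝ) :
    HasDerivAt (growRadius M r) ((2 * velConst * M + 1) * growRadius M r s) s := by
  have := (((hasDerivAt_id s).const_mul (2 * velConst * M + 1)).exp).const_mul r
  refine (this.congr_deriv ?_)
  simp only [growRadius, id]
  ring

/-- Smooth space-time functions with the initial datum, the sup bound, and the support bound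
that the transport iteration preserves. -/
structure Admissible (σ₀ : Plane → ℝ) (M r : ℝ) (f : ℝ × Plane → ℝ) : Prop where
  smooth : ContDiff ℝ (⊤ : ℕ∞) f
  initial : ∀ x, f (0, x) = σ₀ x
  bound : ∀ p, |f p| ≤ M
  supp : ∀ p : ℝ × Plane, growRadius M r |p.1| < ‖p.2‖ → f p = 0

namespace Admissible

variable {σ₀ : Plane → ℝ} {M r : ℝ} {f : ℝ × Plane → ℝ}

lemma nonneg (hf : Admissible σ₀ M r f) : 0 ≤ M := (abs_nonneg _).trans (hf.bound 0)

lemma suppIn (hr : 1 ≤ r) (hf : Admissible σ₀ M r f) : SuppIn (growRadius M r) f :=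
  fun _ p hp hpR => hf.supp p ((growRadius_mono hf.nonneg hr hp.le).trans_lt hpR)

lemma norm_velField_le (hr : 1 ≤ r) (hf : Admissible σ₀ M r f) (p : ℝ × Plane) :
    ‖velField f p‖ ≤ 2 * velConst * (M * growRadius M r |p.1|) :=
  _root_.norm_velField_le (growRadius_pos hr _) hf.nonneg p (fun _ => hf.bound _)
    fun x hx => hf.supp (p.1, x) hx

lemma velField_bounded_on_slabs (hr : 1 ≤ r) (hf : Admissible σ₀ M r f) (T : ℝ) :
    ∃ K : ℝ, ∀ p : ℝ × Plane, |p.1| ≤ T → ‖velField f p‖ ≤ K := by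
  refine ⟨2 * velConst * (M * growRadius M r T), fun p hp => (hf.norm_velField_le hr p).trans ?_⟩
  have := velConst_nonneg
  have := hf.nonneg
  have := growRadius_mono this hr hp
  gcongr

lemma hasTrajectories (hr : 1 ≤ r) (hf : Admissible σ₀ M r f) : HasTrajectories (velField f) :=
  .of_bounded_on_slabs (contDiff_velField hf.smooth (hf.suppIn hr))
    (hf.velField_bounded_on_slabs hr)

/-- A solution of the transport equation along an admissible velocity field is admissible. -/
lemma of_transport (hr : 1 ≤ r) (hf : Admissible σ₀ M r f) {g : ℝ × Plane → ℝ}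
    (hg : ContDiff ℝ (⊤ : ℕ∞) g) (hg0 : ∀ x, g (0, x) = σ₀ x)
    (hgV : ∀ p, fderiv ℝ g p (1, velField f p) = 0) : Admissible σ₀ M r g where
  smooth := hg
  initial := hg0
  bound p := by
    obtain ⟨a, ha⟩ := transport_eq_initial (hf.hasTrajectories hr) (differentiable_of_smooth hg)
      hgV p
    rw [ha, hg0, ← hf.initial]
    exact hf.bound _
  supp p hp := by
    refine transport_support (hf.hasTrajectories hr) (differentiable_of_smooth hg) hgV
      (hasDerivAt_growRadius M r) (fun x hx => ?_) (fun q _ => ?_) (le_refl |p.1|) hp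
    · rw [hg0, ← hf.initial]
      exact hf.supp (0, x) (by simpa using hx)
    · have := hf.norm_velField_le hr q
      have := growRadius_pos (M := M) hr |q.1|
      nlinarith

lemma exists_transport (hr : 1 ≤ r) (hf : Admissible σ₀ M r f) :
    ∃ g, Admissible σ₀ M r g ∧ ∀ p, fderiv ℝ g p (1, velField f p) = 0 := by
  have h0 : ContDiff ℝ (⊤ : ℕ∞) σ₀ := by
    have : σ₀ = fun x => f (0, x) := funext fun x => (hf.initial x).symm
    rw [this]
    exact hf.smooth.comp (contDiff_const.prodMk contDiff_id)
  obtain ⟨g, hg, hg0, hgV⟩ := _root_.exists_transport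
    (contDiff_velField hf.smooth (hf.suppIn hr)) (hf.velField_bounded_on_slabs hr) h0
  exact ⟨g, hf.of_transport hr hg hg0 hgV, hgV⟩

end Admissible

/-- A Picard iteration for the transport equation. -/
structure Iteration (σ₀ : Plane → ℝ) (M r : ℝ) (σ : ℕ → ℝ × Plane → ℝ) : Prop where
  zero : σ 0 = fun p => σ₀ p.2
  adm : ∀ n, Admissible σ₀ M r (σ n)
  step : ∀ n p, fderiv ℝ (σ (n + 1)) p (1, velField (σ n) p) = 0

lemma exists_iteration {σ₀ : Plane → ℝ} {M r : ℝ} (hr : 1 ≤ r)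
    (h0 : ContDiff ℝ (⊤ : ℕ∞) σ₀) (hM : ∀ x, |σ₀ x| ≤ M) (hs : ∀ x, r < ‖x‖ → σ₀ x = 0) :
    ∃ σ, Iteration σ₀ M r σ := by
  have hM0 : 0 ≤ M := (abs_nonneg _).trans (hM 0)
  have hadm : Admissible σ₀ M r fun p => σ₀ p.2 :=
    ⟨h0.comp contDiff_snd, fun _ => rfl, fun p => hM _, fun p hp => hs _ (lt_of_le_of_lt (by
      have := growRadius_mono hM0 hr (abs_nonneg p.1)
      simpa [growRadius] using this) hp)⟩
  choose next hnext using fun f : {f // Admissible σ₀ M r f} => f.2.exists_transport hr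
  let s : ℕ → {f // Admissible σ₀ M r f} := fun n =>
    Nat.rec ⟨_, hadm⟩ (fun _ f => ⟨next f, (hnext f).1⟩) n
  exact ⟨fun n => (s n).1, rfl, fun n => (s n).2, fun n p => (hnext (s n)).2 p⟩

lemma hasFDerivAt_slice {f : ℝ × Plane → ℝ} (hf : Differentiable ℝ f) (t : ℝ) (x : Plane) :
    HasFDerivAt (fun y => f (t, y))
      ((fderiv ℝ f (t, x)).comp (ContinuousLinearMap.inr ℝ ℝ Plane)) x :=
  (hf (t, x)).hasFDerivAt.comp x (hasFDerivAt_prodMk_right t x)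

lemma fderiv_slice {f : ℝ × Plane → ℝ} (hf : Differentiable ℝ f) (t : ℝ) (x : Plane)
    (i : Fin 2) :
    fderiv ℝ (fun y => f (t, y)) x (EuclideanSpace.single i 1) = dd (spaceDir i) f (t, x) := by
  rw [(hasFDerivAt_slice hf t x).fderiv]
  simp [dd, spaceDir]

lemma dd_spaceDir_congr {f g : ℝ × Plane → ℝ} (hf : Differentiable ℝ f)
    (hg : Differentiable ℝ g) {t : ℝ} (h : ∀ x, f (t, x) = g (t, x)) (i : Fin 2) (x : Plane) :
    dd (spaceDir i) f (t, x) = dd (spaceDir i) g (t, x) := by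
  rw [← fderiv_slice hf, ← fderiv_slice hg, funext h]

/-- The material derivative of `g` along the velocity field generated by `f`. -/
def material (f g : ℝ × Plane → ℝ) (p : ℝ × Plane) : ℝ := fderiv ℝ g p (1, velField f p)

lemma material_eq (f g : ℝ × Plane → ℝ) (p : ℝ × Plane) :
    material f g p = dd timeDir g p
      + (vel 0 f p * dd (spaceDir 0) g p + vel 1 f p * dd (spaceDir 1) g p) := by
  rw [material, fderiv_apply_one, Fin.sum_univ_two]
  rfl

lemma material_dd_spaceDir {R : ℝ → ℝ} {f g : ℝ × Plane → ℝ} (hf : ContDiff ℝ (⊤ : ℕ∞) f)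
    (hfR : SuppIn R f) (hg : ContDiff ℝ (⊤ : ℕ∞) g) (i : Fin 2) (p : ℝ × Plane) :
    material f (dd (spaceDir i) g) p = dd (spaceDir i) (material f g) p
      + -(dd (spaceDir i) (vel 0 f) p * dd (spaceDir 0) g p
        + dd (spaceDir i) (vel 1 f) p * dd (spaceDir 1) g p) := by
  have hV := fun l => differentiable_of_smooth (contDiff_vel l hf hfR)
  have hd := fun v => differentiable_of_smooth (hg.dd v)
  rw [show material f g = _ from funext (material_eq f g), dd_add (hd _)
    (((hV 0).fun_mul (hd _)).fun_add ((hV 1).fun_mul (hd _))),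
    dd_add ((hV 0).fun_mul (hd _)) ((hV 1).fun_mul (hd _)),
    dd_mul (hV 0) (hd _), dd_mul (hV 1) (hd _), material_eq, dd_comm hg timeDir,
    dd_comm hg (spaceDir 0) (spaceDir i), dd_comm hg (spaceDir 1) (spaceDir i)]
  ring

/-- The constant of the logarithmic estimate for data bounded by `M` supported in radius `R`. -/
def logConst (M R : ℝ) : ℝ := discArea / Real.pi * (1 + 3 * M) * (2 * R + R ^ 2 + 2)

lemma logConst_nonneg {M R : ℝ} (hM : 0 ≤ M) (hR : 0 ≤ R) : 0 ≤ logConst M R := by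
  have := discArea_nonneg
  have := Real.pi_pos
  unfold logConst; positivity

lemma Admissible.abs_dd_vel_le {σ₀ : Plane → ℝ} {M r : ℝ} {f : ℝ × Plane → ℝ} (hr : 1 ≤ r)
    (hf : Admissible σ₀ M r f) (i l : Fin 2) {a T : ℝ} (ha : 0 ≤ a) {p : ℝ × Plane}
    (hp : |p.1| ≤ T) (h : ∀ x, |dd (spaceDir i) f (p.1, x)| ≤ a) :
    |dd (spaceDir i) (vel l f) p| ≤ logConst M (growRadius M r T) * (1 + Real.log (1 + a)) := by
  have hT : 0 ≤ T := (abs_nonneg _).trans hp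
  have href := hf.smooth.reflect
  have hdr := differentiable_of_smooth href
  have h1 : dd (spaceDir i) (vel l f) p
      = conv (bsComp l) (fun q => dd (spaceDir i) (reflect f) q) p :=
    fderiv_conv (locallyIntegrable_bsComp l) href (hf.suppIn hr).reflect p _
  rw [h1]
  have hsl : ∀ x, fderiv ℝ (fun y => reflect f (p.1, y)) x (EuclideanSpace.single i 1)
      = dd (spaceDir i) (reflect f) (p.1, x) := fun x => fderiv_slice hdr p.1 x i
  have := abs_integral_bsComp_fderiv_le l (φ := fun x => reflect f (p.1, x)) (M := M) (a := a)
    (R := growRadius M r T) (u := EuclideanSpace.single i 1)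
    ((href.comp (contDiff_const.prodMk contDiff_id)).of_le (by exact_mod_cast le_top))
    (one_le_growRadius hf.nonneg hr hT) hf.nonneg ha (by simp) (fun x => hf.bound _)
    (fun x => by
      rw [hsl, dd_reflect (differentiable_of_smooth hf.smooth)]
      have : ((spaceDir i).1, -(spaceDir i).2) = -spaceDir i := by simp [spaceDir]
      rw [this, dd_neg_dir]
      simpa [reflect] using h (-x))
    (fun x hx => hf.supp (p.1, -x) (lt_of_le_of_lt (growRadius_mono hf.nonneg hr hp)
      (by simpa using hx))) p.2
  simp_rw [hsl] at this
  exact this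

/-- The functions on space-time that only depend on space, through a test function. -/
def Stationary (f : ℝ × Plane → ℝ) : Prop :=
  ∃ h : Plane → ℝ, ContDiff ℝ (⊤ : ℕ∞) h ∧ HasCompactSupport h ∧ f = fun p => h p.2

lemma Stationary.bounded {f : ℝ × Plane → ℝ} (hf : Stationary f) : ∃ A, ∀ p, |f p| ≤ A := by
  obtain ⟨h, h1, h2, rfl⟩ := hf
  obtain ⟨A, hA⟩ := h1.continuous.bounded_above_of_compact_support h2
  exact ⟨A, fun p => hA p.2⟩

lemma Stationary.dd_spaceDir {f : ℝ × Plane → ℝ} (hf : Stationary f) (i : Fin 2) :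
    Stationary (dd (spaceDir i) f) := by
  obtain ⟨h, h1, h2, rfl⟩ := hf
  refine ⟨fun x => fderiv ℝ h x (EuclideanSpace.single i 1),
    (h1.fderiv_right (m := (⊤ : ℕ∞)) (by exact_mod_cast le_top)).clm_apply contDiff_const,
    h2.fderiv_apply (𝕜 := ℝ) _, ?_⟩
  funext p
  have : HasFDerivAt (fun p : ℝ × Plane => h p.2) _ p :=
    ((h1.differentiable (by simp)) p.2).hasFDerivAt.comp p (hasFDerivAt_snd (p := p))
  rw [dd, this.fderiv]
  simp [spaceDir]

lemma Iteration.stationary {σ₀ : Plane → ℝ} {M r : ℝ} {σ : ℕ → ℝ × Plane → ℝ}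
    (hr : 1 ≤ r) (hσ : Iteration σ₀ M r σ) : Stationary (σ 0) := by
  have h0 := hσ.adm 0
  refine ⟨fun x => σ 0 (0, x), h0.smooth.comp (contDiff_const.prodMk contDiff_id), ?_, ?_⟩
  · exact HasCompactSupport.intro (isCompact_closedBall (0 : Plane) (growRadius M r 1))
      fun x hx => h0.suppIn hr 1 (0, x) (by simp) (by simpa using hx)
  · rw [hσ.zero]

lemma Iteration.material_eq_zero {σ₀ : Plane → ℝ} {M r : ℝ} {σ : ℕ → ℝ × Plane → ℝ}
    (hσ : Iteration σ₀ M r σ) (n : ℕ) : material (σ n) (σ (n + 1)) = fun _ => 0 :=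
  funext fun p => hσ.step n p

/-- The spatial gradients of the iterates are uniformly bounded on slabs. -/
lemma Iteration.gradient_bounded {σ₀ : Plane → ℝ} {M r : ℝ} {σ : ℕ → ℝ × Plane → ℝ}
    (hr : 1 ≤ r) (hσ : Iteration σ₀ M r σ) (T : ℝ) :
    ∃ A, ∀ i n p, |p.1| ≤ T → |dd (spaceDir i) (σ n) p| ≤ A := by
  rcases lt_or_ge T 0 with hT | hT
  · exact ⟨0, fun i n p hp => absurd ((abs_nonneg _).trans hp) (not_le.2 hT)⟩
  have hM := (hσ.adm 0).nonneg
  obtain ⟨G, hG⟩ : ∃ G, ∀ i p, |dd (spaceDir i) (σ 0) p| ≤ G := by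
    choose G hG using fun i => ((hσ.stationary hr).dd_spaceDir i).bounded
    exact ⟨max (G 0) (G 1), fun i p => (hG i p).trans (by fin_cases i <;> simp)⟩
  have hG0 : 0 ≤ G := (abs_nonneg _).trans (hG 0 0)
  set C := logConst M (growRadius M r T) with hC
  have hC0 : 0 ≤ C := logConst_nonneg hM (growRadius_pos hr T).le
  set μ := 6 * C + 1 with hμ
  set B : ℝ → ℝ := fun s => (G + 1) * Real.exp (μ * s) with hB
  have hBd : ∀ s, HasDerivAt B (μ * B s) s := fun s => by
    refine ((((hasDerivAt_id s).const_mul μ).exp).const_mul (G + 1)).congr_deriv ?_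
    simp only [hB, id]; ring
  have hB1 : ∀ s, 0 ≤ s → G + 1 ≤ B s := fun s hs => by
    have : 1 ≤ Real.exp (μ * s) := Real.one_le_exp (by positivity)
    simp only [hB]; nlinarith
  have hBm : ∀ s, s ≤ T → B s ≤ B T := fun s hs => by
    simp only [hB]; gcongr
  have hGB : ∀ s, 0 ≤ s → G ≤ Real.exp (B s) := fun s hs => by
    have := Real.add_one_le_exp (B s)
    have := hB1 s hs
    linarith
  have key : ∀ n, ∀ p : ℝ × Plane, |p.1| ≤ T →
      ‖fun i : Fin 2 => dd (spaceDir i) (σ n) p‖ ≤ Real.exp (B |p.1|) := by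
    intro n
    induction n with
    | zero =>
      intro p hp
      exact (pi_norm_le_iff_of_nonneg (Real.exp_pos _).le).2 fun i =>
        (hG i p).trans (hGB _ (abs_nonneg _))
    | succ n ih =>
      intro p hp
      have hn := hσ.adm n
      have hn1 := hσ.adm (n + 1)
      have hdw : ∀ i, Differentiable ℝ (dd (spaceDir i) (σ (n + 1))) := fun i =>
        differentiable_of_smooth (hn1.smooth.dd _)
      refine transport_comparison (hn.hasTrajectories hr)
        (w := fun p (i : Fin 2) => dd (spaceDir i) (σ (n + 1)) p)
        (differentiable_pi.2 hdw) (B := fun s => Real.exp (B s)) (fun s => (hBd s).exp)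
        (fun x => ?_) (T := T) (fun q hq hqB => ?_) hp
      · refine (pi_norm_le_iff_of_nonneg (Real.exp_pos _).le).2 fun i => ?_
        rw [dd_spaceDir_congr (differentiable_of_smooth hn1.smooth)
          (differentiable_of_smooth (hσ.adm 0).smooth)
          (fun x => by rw [hn1.initial, (hσ.adm 0).initial])]
        exact (hG i _).trans (hGB _ le_rfl)
      · have hBq := hB1 _ (abs_nonneg q.1)
        have hBq1 : 1 ≤ B |q.1| := by linarith
        have hE := Real.exp_pos (B |q.1|)
        have hlog : Real.log (1 + Real.exp (B |q.1|)) ≤ 1 + B |q.1| := by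
          rw [← Real.log_exp (1 + B |q.1|), Real.exp_add]
          refine Real.log_le_log (by positivity) ?_
          have h2 : (2 : ℝ) ≤ Real.exp 1 := by have := Real.add_one_le_exp (1 : ℝ); linarith
          have h1 : 1 ≤ Real.exp (B |q.1|) := Real.one_le_exp (by linarith)
          nlinarith
        have hv : ∀ i l, |dd (spaceDir i) (vel l (σ n)) q| ≤ C * (2 + B |q.1|) := fun i l =>
          (hn.abs_dd_vel_le hr i l hE.le hq.le fun x =>
            (norm_le_pi_norm (fun i : Fin 2 => dd (spaceDir i) (σ n) (q.1, x)) i).trans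
              (ih (q.1, x) hq.le)).trans (mul_le_mul_of_nonneg_left (by linarith) hC0)
        have hg : ∀ l, |dd (spaceDir l) (σ (n + 1)) q| ≤ Real.exp (B |q.1|) := fun l =>
          (norm_le_pi_norm (fun i : Fin 2 => dd (spaceDir i) (σ (n + 1)) q) l).trans hqB.le
        have hlt : 2 * (C * (2 + B |q.1|) * Real.exp (B |q.1|))
            < Real.exp (B |q.1|) * (μ * B |q.1|) := by
          have : 2 * (C * (2 + B |q.1|)) < μ * B |q.1| := by
            rw [hμ]; nlinarith [mul_le_mul_of_nonneg_left hBq1 hC0]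
          nlinarith
        refine (pi_norm_lt_iff (by positivity)).2 fun i => ?_
        rw [fderiv_pi fun i => hdw i q]
        have : fderiv ℝ (dd (spaceDir i) (σ (n + 1))) q (1, velField (σ n) q)
            = _ := material_dd_spaceDir hn.smooth (hn.suppIn hr) hn1.smooth i q
        refine lt_of_eq_of_lt (congrArg norm this) ?_
        rw [hσ.material_eq_zero, Real.norm_eq_abs]
        simp only [dd, fderiv_fun_const, Pi.zero_apply, zero_apply, zero_add, abs_neg]
        refine lt_of_le_of_lt ((abs_add_le _ _).trans ?_) hlt
        rw [abs_mul, abs_mul, two_mul]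
        have hnn : 0 ≤ C * (2 + B |q.1|) := by positivity
        exact add_le_add (mul_le_mul (hv i 0) (hg 0) (abs_nonneg _) hnn)
          (mul_le_mul (hv i 1) (hg 1) (abs_nonneg _) hnn)
  refine ⟨Real.exp (B T), fun i n p hp => ?_⟩
  exact (norm_le_pi_norm (fun i : Fin 2 => dd (spaceDir i) (σ n) p) i).trans
    ((key n p hp).trans (Real.exp_le_exp.2 (hBm _ hp)))

/-- Iterated spatial coordinate derivatives. -/
def wd : List (Fin 2) → (ℝ × Plane → ℝ) → ℝ × Plane → ℝ
  | [], f => f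
  | i :: w, f => dd (spaceDir i) (wd w f)

lemma ContDiff.wd {f : ℝ × Plane → ℝ} (hf : ContDiff ℝ (⊤ : ℕ∞) f) :
    ∀ w, ContDiff ℝ (⊤ : ℕ∞) (wd w f)
  | [] => hf
  | _ :: w => (hf.wd w).dd _

lemma SuppIn.wd {R : ℝ → ℝ} {f : ℝ × Plane → ℝ} (hf : SuppIn R f) : ∀ w, SuppIn R (wd w f)
  | [] => hf
  | _ :: w => (hf.wd w).dd _

lemma Stationary.wd {f : ℝ × Plane → ℝ} (hf : Stationary f) : ∀ w, Stationary (wd w f)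
  | [] => hf
  | _ :: w => (hf.wd w).dd_spaceDir _

lemma wd_congr {f g : ℝ × Plane → ℝ} (hf : ContDiff ℝ (⊤ : ℕ∞) f)
    (hg : ContDiff ℝ (⊤ : ℕ∞) g) {t : ℝ} (h : ∀ x, f (t, x) = g (t, x)) :
    ∀ w x, wd w f (t, x) = wd w g (t, x)
  | [], x => h x
  | i :: w, x => dd_spaceDir_congr (differentiable_of_smooth (hf.wd w))
      (differentiable_of_smooth (hg.wd w)) (wd_congr hf hg h w) i x

lemma wd_vel (l : Fin 2) {R : ℝ → ℝ} {f : ℝ × Plane → ℝ} (hf : ContDiff ℝ (⊤ : ℕ∞) f)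
    (hfR : SuppIn R f) :
    ∀ w, wd w (vel l f) = vel l (wd w f) ∨ wd w (vel l f) = fun p => -vel l (wd w f) p
  | [] => Or.inl rfl
  | i :: w => by
    have h := dd_spaceDir_vel l (hf.wd w) (hfR.wd w) i
    rcases wd_vel l hf hfR w with h' | h'
    · right
      rw [wd, h', h]; rfl
    · left
      rw [wd, h', dd_neg, h]
      simp only [neg_neg]; rfl

lemma abs_wd_vel_le (l : Fin 2) {T R' A : ℝ} {R : ℝ → ℝ} {f : ℝ × Plane → ℝ}
    (hf : ContDiff ℝ (⊤ : ℕ∞) f) (hfR : SuppIn R f) (hR' : 0 < R') (hRR : R T ≤ R') (hA : 0 ≤ A)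
    (w : List (Fin 2)) {p : ℝ × Plane} (hp : |p.1| < T) (h : ∀ x, |wd w f (p.1, x)| ≤ A) :
    |wd w (vel l f) p| ≤ velConst * (A * R') := by
  have := abs_vel_le l hR' hA p h fun x hx => hfR.wd w T (p.1, x) hp (hRR.trans_lt hx)
  rcases wd_vel l hf hfR w with h' | h'
  · rwa [h']
  · rwa [h', abs_neg]

/-- Sums of at most `c` products `∂^β u ∂^γ g` with `|β| + |γ| = m` and `|β|, |γ| ≥ 1`, where `u`
is a component of the velocity field generated by `f`. -/
inductive CommTerms (f g : ℝ × Plane → ℝ) : ℕ → ℕ → (ℝ × Plane → ℝ) → Prop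
  | term (l : Fin 2) (β γ : List (Fin 2)) (m : ℕ) (hβ : 1 ≤ β.length) (hγ : 1 ≤ γ.length)
      (h : β.length + γ.length = m) :
      CommTerms f g m 1 fun p => wd β (vel l f) p * wd γ g p
  | neg {m c N} : CommTerms f g m c N → CommTerms f g m c fun p => -N p
  | add {m c c' N N'} : CommTerms f g m c N → CommTerms f g m c' N' →
      CommTerms f g m (c + c') fun p => N p + N' p

namespace CommTerms

variable {f g : ℝ × Plane → ℝ} {R : ℝ → ℝ}

lemma smooth (hf : ContDiff ℝ (⊤ : ℕ∞) f) (hfR : SuppIn R f) (hg : ContDiff ℝ (⊤ : ℕ∞) g)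
    {m c : ℕ} {N} (h : CommTerms f g m c N) : ContDiff ℝ (⊤ : ℕ∞) N := by
  induction h with
  | term l β γ m hβ hγ h => exact ((contDiff_vel l hf hfR).wd β).mul (hg.wd γ)
  | neg _ ih => exact ih.neg
  | add _ _ ih ih' => exact ih.add ih'

lemma dd_spaceDir (hf : ContDiff ℝ (⊤ : ℕ∞) f) (hfR : SuppIn R f) (hg : ContDiff ℝ (⊤ : ℕ∞) g)
    (i : Fin 2) {m c : ℕ} {N} (h : CommTerms f g m c N) :
    CommTerms f g (m + 1) (c + c) (dd (spaceDir i) N) := by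
  induction h with
  | term l β γ m hβ hγ h =>
    rw [dd_mul (differentiable_of_smooth ((contDiff_vel l hf hfR).wd β))
      (differentiable_of_smooth (hg.wd γ))]
    exact (term l (i :: β) γ _ (by simp) hγ (by simp; omega)).add
      (term l β (i :: γ) _ hβ (by simp) (by simp; omega))
  | neg _ ih =>
    rw [dd_neg]
    exact ih.neg
  | @add m c c' N N' h h' ih ih' =>
    rw [dd_add (differentiable_of_smooth (h.smooth hf hfR hg))
      (differentiable_of_smooth (h'.smooth hf hfR hg)),
      show c + c' + (c + c') = (c + c) + (c' + c') by ring]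
    exact ih.add ih'

lemma abs_le {m c : ℕ} {N} (h : CommTerms f g m c N) {p : ℝ × Plane} {b : ℝ}
    (hb : ∀ l β γ, 1 ≤ β.length → 1 ≤ γ.length → β.length + γ.length = m →
      |wd β (vel l f) p * wd γ g p| ≤ b) : |N p| ≤ c * b := by
  induction h with
  | term l β γ m hβ hγ h => simpa using hb l β γ hβ hγ h
  | neg _ ih => simpa using ih hb
  | add _ _ ih ih' =>
    push_cast
    rw [add_mul]
    exact (abs_add_le _ _).trans (add_le_add (ih hb) (ih' hb))

/-- The spatial derivatives of a transported function solve a transport equation whose source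
consists of commutator terms. -/
lemma exists_material_wd (k : ℕ) : ∃ c, ∀ {f g : ℝ × Plane → ℝ} {R : ℝ → ℝ},
    ContDiff ℝ (⊤ : ℕ∞) f → SuppIn R f → ContDiff ℝ (⊤ : ℕ∞) g →
    material f g = (fun _ => 0) → ∀ w : List (Fin 2), w.length = k + 1 →
      CommTerms f g (k + 2) c (material f (wd w g)) := by
  have hsum : ∀ {f g : ℝ × Plane → ℝ} (i : Fin 2) (w : List (Fin 2)),
      CommTerms f g (w.length + 2) (1 + 1) fun p =>
        -(dd (spaceDir i) (vel 0 f) p * dd (spaceDir 0) (wd w g) p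
        + dd (spaceDir i) (vel 1 f) p * dd (spaceDir 1) (wd w g) p) := fun i w =>
    ((term 0 [i] (0 :: w) _ (by simp) (by simp) (by simp; omega)).add
      (term 1 [i] (1 :: w) _ (by simp) (by simp) (by simp; omega))).neg
  induction k with
  | zero =>
    refine ⟨1 + 1, fun {f g R} hf hfR hg h w hw => ?_⟩
    obtain ⟨i, rfl⟩ := List.length_eq_one_iff.1 hw
    have := hsum (f := f) (g := g) i []
    convert (show CommTerms f g (0 + 2) (1 + 1) _ from this) using 1
    funext p
    simp only [wd]
    rw [material_dd_spaceDir hf hfR hg, h]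
    simp [dd]
  | succ k ih =>
    obtain ⟨c, hc⟩ := ih
    refine ⟨c + c + (1 + 1), fun {f g R} hf hfR hg h w hw => ?_⟩
    obtain ⟨i, w, rfl⟩ := List.exists_cons_of_length_eq_add_one hw
    have hw' : w.length = k + 1 := by simpa using hw
    have h1 := (hc hf hfR hg h w hw').dd_spaceDir hf hfR hg i
    have h2 := hsum (f := f) (g := g) i w
    rw [hw'] at h2
    convert h1.add h2 using 1
    funext p
    rw [wd, material_dd_spaceDir hf hfR (hg.wd w)]

end CommTerms

/-- All spatial derivatives of the iterates are uniformly bounded on slabs. -/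
lemma Iteration.wd_bounded {σ₀ : Plane → ℝ} {M r : ℝ} {σ : ℕ → ℝ × Plane → ℝ}
    (hr : 1 ≤ r) (hσ : Iteration σ₀ M r σ) (T : ℝ) (k : ℕ) :
    ∃ A, ∀ w : List (Fin 2), w.length ≤ k + 1 → ∀ n p, |p.1| ≤ T → |wd w (σ n) p| ≤ A := by
  have hM := (hσ.adm 0).nonneg
  induction k with
  | zero =>
    obtain ⟨A, hA⟩ := hσ.gradient_bounded hr T
    refine ⟨max M A, fun w hw n p hp => ?_⟩
    rcases w with _ | ⟨i, _ | ⟨j, w⟩⟩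
    · exact ((hσ.adm n).bound p).trans (le_max_left _ _)
    · exact (hA i n p hp).trans (le_max_right _ _)
    · simp at hw
  | succ k ih =>
    obtain ⟨A, hA⟩ := ih
    set K := k + 2 with hK
    obtain ⟨G, hG⟩ : ∃ G, ∀ w : List.Vector (Fin 2) K, ∀ p, |wd w.1 (σ 0) p| ≤ G := by
      choose G hG using fun w : List.Vector (Fin 2) K => ((hσ.stationary hr).wd w.1).bounded
      exact ⟨∑ w, |G w|, fun w p => (hG w p).trans ((le_abs_self _).trans
        (Finset.single_le_sum (f := fun w => |G w|) (fun _ _ => abs_nonneg _)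
          (Finset.mem_univ w)))⟩
    obtain ⟨c, hc⟩ := CommTerms.exists_material_wd (k + 1)
    set R' := growRadius M r (T + 1)
    have hR' : 0 < R' := growRadius_pos hr _
    have hC0 := velConst_nonneg
    set b := max |A| |G| + 1 with hb
    have hb1 : 1 ≤ b := by have := abs_nonneg A; have := le_max_left |A| |G|; linarith
    have hAb : |A| ≤ b := by have := le_max_left |A| |G|; linarith
    have hGb : G ≤ b := by have := (le_abs_self G).trans (le_max_right |A| |G|); linarith
    set μ := 2 * (c * (velConst * R' * |A|)) + 1 with hμ
    have hμ0 : 0 < μ := by positivity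
    set B : ℝ → ℝ := fun s => b * Real.exp (μ * s) with hB
    have hBd : ∀ s, HasDerivAt B (μ * B s) s := fun s => by
      refine ((((hasDerivAt_id s).const_mul μ).exp).const_mul b).congr_deriv ?_
      simp only [hB, id]; ring
    have hB1 : ∀ s, 0 ≤ s → b ≤ B s := fun s hs => by
      have : 1 ≤ Real.exp (μ * s) := Real.one_le_exp (by positivity)
      simp only [hB]; nlinarith
    have hBm : ∀ s, s ≤ T → B s ≤ B T := fun s hs => by
      simp only [hB]; gcongr
    have key : ∀ n, ∀ p : ℝ × Plane, |p.1| ≤ T →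
        ‖fun w : List.Vector (Fin 2) K => wd w.1 (σ n) p‖ ≤ B |p.1| := by
      intro n
      have hB0 : ∀ s, 0 ≤ s → 0 ≤ B s := fun s hs => by linarith [hB1 s hs]
      induction n with
      | zero =>
        intro p hp
        exact (pi_norm_le_iff_of_nonneg (hB0 _ (abs_nonneg _))).2 fun w =>
          (hG w p).trans (hGb.trans (hB1 _ (abs_nonneg _)))
      | succ n ihn =>
        intro p hp
        have hn := hσ.adm n
        have hn1 := hσ.adm (n + 1)
        have hdw : ∀ w : List.Vector (Fin 2) K, Differentiable ℝ (wd w.1 (σ (n + 1))) :=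
          fun w => differentiable_of_smooth (hn1.smooth.wd _)
        refine transport_comparison (hn.hasTrajectories hr)
          (w := fun p (w : List.Vector (Fin 2) K) => wd w.1 (σ (n + 1)) p)
          (differentiable_pi.2 hdw) hBd (fun x => ?_) (T := T) (fun q hq hqB => ?_) hp
        · refine (pi_norm_le_iff_of_nonneg (hB0 _ le_rfl)).2 fun w => ?_
          rw [wd_congr hn1.smooth (hσ.adm 0).smooth
            (fun x => by rw [hn1.initial, (hσ.adm 0).initial])]
          exact (hG w _).trans (hGb.trans (hB1 _ le_rfl))
        · have hBq := hB1 _ (abs_nonneg q.1)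
          have hBq0 := hB0 _ (abs_nonneg q.1)
          have hA' : |A| ≤ B |q.1| := hAb.trans hBq
          have hf : ∀ m, m = n ∨ m = n + 1 → ∀ w : List (Fin 2), w.length ≤ K → ∀ x,
              |wd w (σ m) (q.1, x)| ≤ B |q.1| ∨ m = n + 1 := by
            rintro m (rfl | rfl) w hw x
            · left
              rcases hw.lt_or_eq with h | h
              · exact (hA w (by omega) m (q.1, x) hq.le).trans ((le_abs_self A).trans hA')
              · exact (norm_le_pi_norm (fun w : List.Vector (Fin 2) K => wd w.1 (σ m) (q.1, x))
                  ⟨w, h⟩).trans (ihn (q.1, x) hq.le)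
            · exact Or.inr rfl
          have hv : ∀ l (β : List (Fin 2)), β.length ≤ K →
              |wd β (vel l (σ n)) q| ≤ velConst * (B |q.1| * R') := fun l β hβ =>
            abs_wd_vel_le l hn.smooth (hn.suppIn hr) hR' le_rfl hBq0 β (by linarith)
              fun x => (hf n (Or.inl rfl) β hβ x).resolve_right (by omega)
          have hvA : ∀ l (β : List (Fin 2)), β.length ≤ k + 1 →
              |wd β (vel l (σ n)) q| ≤ velConst * (|A| * R') := fun l β hβ =>
            abs_wd_vel_le l hn.smooth (hn.suppIn hr) hR' le_rfl (abs_nonneg A) β (by linarith)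
              fun x => (hA β hβ n (q.1, x) hq.le).trans (le_abs_self A)
          have hgA : ∀ γ : List (Fin 2), γ.length ≤ k + 1 → |wd γ (σ (n + 1)) q| ≤ |A| :=
            fun γ hγ => (hA γ hγ (n + 1) q hq.le).trans (le_abs_self A)
          have hg : ∀ γ : List (Fin 2), γ.length ≤ K → |wd γ (σ (n + 1)) q| ≤ B |q.1| := by
            intro γ hγ
            rcases hγ.lt_or_eq with h | h
            · exact (hgA γ (by omega)).trans hA'
            · exact (norm_le_pi_norm (fun w : List.Vector (Fin 2) K => wd w.1 (σ (n + 1)) q)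
                ⟨γ, h⟩).trans hqB.le
          refine (pi_norm_lt_iff (mul_pos hμ0 (by linarith))).2 fun w => ?_
          rw [fderiv_pi fun w => hdw w q]
          have hcomm := hc hn.smooth (hn.suppIn hr) hn1.smooth (hσ.material_eq_zero n) w.1 w.2
          refine lt_of_le_of_lt (hcomm.abs_le (p := q)
            (b := velConst * R' * |A| * B |q.1|) fun l β γ hβ hγ hβγ => ?_) ?_
          · rw [abs_mul]
            by_cases h : β.length ≤ k + 1
            · calc _ ≤ velConst * (|A| * R') * B |q.1| :=
                    mul_le_mul (hvA l β h) (hg γ (by omega)) (abs_nonneg _) (by positivity)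
                _ = _ := by ring
            · calc _ ≤ velConst * (B |q.1| * R') * |A| :=
                    mul_le_mul (hv l β (by omega)) (hgA γ (by omega)) (abs_nonneg _)
                      (by positivity)
                _ = _ := by ring
          · have h0 : 0 ≤ c * (velConst * R' * |A|) * B |q.1| := by positivity
            rw [hμ]
            nlinarith
    refine ⟨max |A| (B T), fun w hw n p hp => ?_⟩
    rcases hw.lt_or_eq with h | h
    · exact (hA w (by omega) n p hp).trans ((le_abs_self A).trans (le_max_left _ _))
    · exact (norm_le_pi_norm (fun w : List.Vector (Fin 2) K => wd w.1 (σ n) p)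
        ⟨w, h⟩).trans ((key n p hp).trans ((hBm _ hp).trans (le_max_right _ _)))

lemma integrable_vel (l : Fin 2) {R : ℝ → ℝ} {f : ℝ × Plane → ℝ}
    (hf : ContDiff ℝ (⊤ : ℕ∞) f) (hfR : SuppIn R f) (p : ℝ × Plane) :
    Integrable fun z => bsComp l z * reflect f (p.1, p.2 - z) := by
  have hc : Continuous fun z => reflect f (p.1, p.2 - z) :=
    hf.reflect.continuous.comp (by fun_prop)
  have hs : HasCompactSupport fun z => reflect f (p.1, p.2 - z) := by
    refine HasCompactSupport.of_support_subset_isCompact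
      (isCompact_closedBall (0 : Plane) (R (|p.1| + 1) + ‖p.2‖)) fun z hz => ?_
    by_contra h
    refine hz (hfR.reflect (|p.1| + 1) (p.1, p.2 - z) (by simp) ?_)
    have h1 := norm_sub_norm_le z p.2
    rw [norm_sub_rev] at h1
    simp only [Metric.mem_closedBall, dist_zero_right, not_le] at h
    simp only
    linarith
  have := (locallyIntegrable_bsComp l).integrable_smul_right_of_hasCompactSupport hc hs
  simpa [smul_eq_mul, mul_comm] using this

lemma vel_sub (l : Fin 2) {R R' : ℝ → ℝ} {f g : ℝ × Plane → ℝ}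
    (hf : ContDiff ℝ (⊤ : ℕ∞) f) (hfR : SuppIn R f) (hg : ContDiff ℝ (⊤ : ℕ∞) g)
    (hgR : SuppIn R' g) (p : ℝ × Plane) :
    vel l (fun q => f q - g q) p = vel l f p - vel l g p := by
  simp only [vel, conv]
  rw [← integral_sub (integrable_vel l hf hfR p) (integrable_vel l hg hgR p)]
  simp only [reflect, mul_sub]

lemma abs_vel_sub_le (l : Fin 2) {R : ℝ → ℝ} {f g : ℝ × Plane → ℝ}
    (hf : ContDiff ℝ (⊤ : ℕ∞) f) (hfR : SuppIn R f) (hg : ContDiff ℝ (⊤ : ℕ∞) g)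
    (hgR : SuppIn R g) {T R' D : ℝ} (hR' : 0 < R') (hRR : R T ≤ R') (hD : 0 ≤ D)
    {p : ℝ × Plane} (hp : |p.1| < T) (h : ∀ x, |f (p.1, x) - g (p.1, x)| ≤ D) :
    |vel l f p - vel l g p| ≤ velConst * (D * R') := by
  rw [← vel_sub l hf hfR hg hgR]
  refine abs_vel_le l hR' hD p h fun x hx => ?_
  have hx' := hRR.trans_lt hx
  rw [hfR T (p.1, x) hp hx', hgR T (p.1, x) hp hx', sub_zero]

/-- Successive iterates converge geometrically on slabs. -/
lemma Iteration.abs_sub_le {σ₀ : Plane → ℝ} {M r : ℝ} {σ : ℕ → ℝ × Plane → ℝ}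
    (hr : 1 ≤ r) (hσ : Iteration σ₀ M r σ) (T : ℝ) :
    ∃ C, 0 ≤ C ∧ ∀ n p, |p.1| ≤ T → |σ (n + 1) p - σ n p| ≤ C / 2 ^ n := by
  have hM := (hσ.adm 0).nonneg
  obtain ⟨A, hA⟩ := hσ.gradient_bounded hr T
  set R' := growRadius M r (T + 1)
  have hR' : 0 < R' := growRadius_pos hr _
  have hC0 := velConst_nonneg
  set μ := 4 * (velConst * R' * |A|) + 1 with hμ
  have hμ0 : 0 < μ := by positivity
  set b := 2 * M + 1 with hb
  have hb0 : 0 < b := by positivity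
  have hBd : ∀ (n : ℕ) s, HasDerivAt (fun s => b * Real.exp (μ * s) / 2 ^ n)
      (μ * (b * Real.exp (μ * s) / 2 ^ n)) s := fun n s => by
    refine (((((hasDerivAt_id s).const_mul μ).exp).const_mul b).div_const _).congr_deriv ?_
    simp only [id]; ring
  have key : ∀ n, ∀ p : ℝ × Plane, |p.1| ≤ T →
      ‖σ (n + 1) p - σ n p‖ ≤ b * Real.exp (μ * |p.1|) / 2 ^ n := by
    intro n
    induction n with
    | zero =>
      intro p hp
      have h0 := (hσ.adm 0).bound p
      have h1 := (hσ.adm 1).bound p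
      have h2 : 1 ≤ Real.exp (μ * |p.1|) := Real.one_le_exp (by positivity)
      have h3 := norm_sub_le (σ 1 p) (σ 0 p)
      simp only [Real.norm_eq_abs, zero_add, pow_zero, div_one] at *
      nlinarith
    | succ n ihn =>
      intro p hp
      have hn := hσ.adm n
      have hn1 := hσ.adm (n + 1)
      have hn2 := hσ.adm (n + 2)
      have hd1 := differentiable_of_smooth hn1.smooth
      have hd2 := differentiable_of_smooth hn2.smooth
      refine transport_comparison (hn1.hasTrajectories hr)
        (w := fun p => σ (n + 2) p - σ (n + 1) p)
        (hd2.sub hd1) (hBd (n + 1)) (fun x => ?_) (T := T) (fun q hq _ => ?_) hp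
      · simp only [hn2.initial, hn1.initial, sub_self, norm_zero]
        positivity
      · set E := b * Real.exp (μ * |q.1|) / 2 ^ n with hE
        have hE0 : 0 < E := by positivity
        have hv : ∀ l, |vel l (σ (n + 1)) q - vel l (σ n) q| ≤ velConst * (E * R') := fun l =>
          abs_vel_sub_le l hn1.smooth (hn1.suppIn hr) hn.smooth (hn.suppIn hr) hR' le_rfl hE0.le
            (by linarith) fun x => ihn (q.1, x) hq.le
        have hg : ∀ i, |dd (spaceDir i) (σ (n + 1)) q| ≤ |A| := fun i =>
          (hA i (n + 1) q hq.le).trans (le_abs_self A)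
        have hprod : ∀ l, |(vel l (σ (n + 1)) q - vel l (σ n) q) *
            dd (spaceDir l) (σ (n + 1)) q| ≤ velConst * (E * R') * |A| := fun l => by
          rw [abs_mul]
          exact mul_le_mul (hv l) (hg l) (abs_nonneg _) (by positivity)
        have e1 := congrFun (hσ.material_eq_zero (n + 1)) q
        have e2 := congrFun (hσ.material_eq_zero n) q
        have e : fderiv ℝ (fun p => σ (n + 2) p - σ (n + 1) p) q (1, velField (σ (n + 1)) q)
            = -((vel 0 (σ (n + 1)) q - vel 0 (σ n) q) * dd (spaceDir 0) (σ (n + 1)) q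
              + (vel 1 (σ (n + 1)) q - vel 1 (σ n) q) * dd (spaceDir 1) (σ (n + 1)) q) := by
          rw [fderiv_fun_sub (hd2 q) (hd1 q), sub_apply]
          change material (σ (n + 1)) (σ (n + 2)) q - material (σ (n + 1)) (σ (n + 1)) q = _
          rw [e1]
          rw [material_eq] at e2 ⊢
          linarith
        rw [e, norm_neg, Real.norm_eq_abs]
        refine (abs_add_le _ _).trans_lt ?_
        have h0 := hprod 0
        have h1 := hprod 1
        have : b * Real.exp (μ * |q.1|) / 2 ^ (n + 1) = E / 2 := by
          rw [hE, pow_succ]; ring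
        rw [this, hμ]
        nlinarith
  refine ⟨b * Real.exp (μ * T), by positivity, fun n p hp => (key n p hp).trans ?_⟩
  gcongr

/-- Uniform Cauchy property on the slabs `|t| ≤ T`. -/
def CauchyOnSlabs (f : ℕ → ℝ × Plane → ℝ) : Prop :=
  ∀ T ε, 0 < ε → ∃ N, ∀ m ≥ N, ∀ n ≥ N, ∀ p : ℝ × Plane, |p.1| ≤ T → |f m p - f n p| ≤ ε

lemma Iteration.cauchyOnSlabs {σ₀ : Plane → ℝ} {M r : ℝ} {σ : ℕ → ℝ × Plane → ℝ}
    (hr : 1 ≤ r) (hσ : Iteration σ₀ M r σ) : CauchyOnSlabs σ := by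
  intro T ε hε
  obtain ⟨C, hC, h⟩ := hσ.abs_sub_le hr T
  have key : ∀ N k, ∀ p : ℝ × Plane, |p.1| ≤ T →
      |σ (N + k) p - σ N p| ≤ C / 2 ^ N * (2 - 2 / 2 ^ k) := by
    intro N k p hp
    induction k with
    | zero => simp
    | succ k ih =>
      have h1 := h (N + k) p hp
      have h2 := _root_.abs_sub_le (σ (N + k + 1) p) (σ (N + k) p) (σ N p)
      refine (h2.trans (add_le_add h1 ih)).trans (le_of_eq ?_)
      rw [pow_add, pow_succ]
      field_simp
      ring
  obtain ⟨N, hN⟩ := exists_pow_lt_of_lt_one (y := (1 / 2 : ℝ))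
    (show 0 < ε / (4 * C + 1) by positivity) (by norm_num)
  have hN' : C / 2 ^ N * 4 ≤ ε := by
    rw [lt_div_iff₀ (by positivity), one_div, inv_pow] at hN
    have : (0 : ℝ) < (2 ^ N)⁻¹ := by positivity
    rw [div_eq_mul_inv]
    nlinarith
  have hk : ∀ m ≥ N, ∀ p : ℝ × Plane, |p.1| ≤ T → |σ m p - σ N p| ≤ ε / 2 := by
    intro m hm p hp
    obtain ⟨k, rfl⟩ := Nat.exists_eq_add_of_le hm
    have h1 := key N k p hp
    have h2 : (0 : ℝ) ≤ 2 / 2 ^ k := by positivity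
    have h3 : 0 ≤ C / 2 ^ N := by positivity
    nlinarith
  refine ⟨N, fun m hm n hn p hp => ?_⟩
  have h1 := hk m hm p hp
  have h2 := hk n hn p hp
  have h3 := _root_.abs_sub_le (σ m p) (σ N p) (σ n p)
  rw [abs_sub_comm (σ N p)] at h3
  linarith

/-- Every member of the sequence is smooth. -/
def SmoothSeq (f : ℕ → ℝ × Plane → ℝ) : Prop := ∀ n, ContDiff ℝ (⊤ : ℕ∞) (f n)

/-- Eventual uniform boundedness on slabs. -/
def UBSlabs (f : ℕ → ℝ × Plane → ℝ) : Prop :=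
  ∀ T, ∃ A N, ∀ n ≥ N, ∀ p : ℝ × Plane, |p.1| ≤ T → |f n p| ≤ A

/-- The property `P` holds for all derivatives of order at most `k` along directions in `S`. -/
def IterDD (S : Set (ℝ × Plane)) (P : (ℕ → ℝ × Plane → ℝ) → Prop) :
    ℕ → (ℕ → ℝ × Plane → ℝ) → Prop
  | 0, f => P f
  | k + 1, f => P f ∧ ∀ v ∈ S, IterDD S P k fun n => dd v (f n)

lemma SmoothSeq.dd {f : ℕ → ℝ × Plane → ℝ} (hf : SmoothSeq f) (v : ℝ × Plane) :
    SmoothSeq fun n => dd v (f n) := fun n => (hf n).dd v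

lemma SmoothSeq.differentiable {f : ℕ → ℝ × Plane → ℝ} (hf : SmoothSeq f) (n : ℕ) :
    Differentiable ℝ (f n) := differentiable_of_smooth (hf n)

namespace IterDD

variable {S : Set (ℝ × Plane)} {P : (ℕ → ℝ × Plane → ℝ) → Prop}

lemma base {f : ℕ → ℝ × Plane → ℝ} : ∀ {k}, IterDD S P k f → P f
  | 0, h => h
  | _ + 1, h => h.1

lemma of_succ {k : ℕ} : ∀ {f : ℕ → ℝ × Plane → ℝ}, IterDD S P (k + 1) f → IterDD S P k f := by
  induction k with
  | zero => exact fun h => h.1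
  | succ k ih => exact fun h => ⟨h.1, fun v hv => ih (h.2 v hv)⟩

lemma neg (hP : ∀ f, P f → P fun n p => -f n p) {k : ℕ} :
    ∀ {f : ℕ → ℝ × Plane → ℝ}, IterDD S P k f → IterDD S P k fun n p => -f n p := by
  induction k with
  | zero => exact fun h => hP _ h
  | succ k ih =>
    refine fun {f} h => ⟨hP _ h.1, fun v hv => ?_⟩
    simp only [dd_neg]
    exact ih (h.2 v hv)

lemma add (hP : ∀ f g, SmoothSeq f → SmoothSeq g → P f → P g → P fun n p => f n p + g n p)
    {k : ℕ} : ∀ {f g : ℕ → ℝ × Plane → ℝ}, SmoothSeq f → SmoothSeq g → IterDD S P k f →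
      IterDD S P k g → IterDD S P k fun n p => f n p + g n p := by
  induction k with
  | zero => exact fun hf hg h h' => hP _ _ hf hg h h'
  | succ k ih =>
    refine fun {f g} hf hg h h' => ⟨hP _ _ hf hg h.1 h'.1, fun v hv => ?_⟩
    simp only [dd_add (hf.differentiable _) (hg.differentiable _)]
    exact ih (hf.dd v) (hg.dd v) (h.2 v hv) (h'.2 v hv)

lemma mul (hadd : ∀ f g, SmoothSeq f → SmoothSeq g → P f → P g → P fun n p => f n p + g n p)
    (hP : ∀ f g, SmoothSeq f → SmoothSeq g → P f → P g → P fun n p => f n p * g n p) {k : ℕ} :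
    ∀ {f g : ℕ → ℝ × Plane → ℝ}, SmoothSeq f → SmoothSeq g → IterDD S P k f → IterDD S P k g →
      IterDD S P k fun n p => f n p * g n p := by
  induction k with
  | zero => exact fun hf hg h h' => hP _ _ hf hg h h'
  | succ k ih =>
    refine fun {f g} hf hg h h' => ⟨hP _ _ hf hg h.1 h'.1, fun v hv => ?_⟩
    simp only [dd_mul (hf.differentiable _) (hg.differentiable _)]
    exact add hadd (fun n => ((hf n).dd v).mul (hg n)) (fun n => (hf n).mul ((hg n).dd v))
      (ih (hf.dd v) hg (h.2 v hv) h'.of_succ) (ih hf (hg.dd v) h.of_succ (h'.2 v hv))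

lemma dd_dir {u : ℝ × Plane} (hP : ∀ f, P f → P fun n => dd u (f n)) {k : ℕ} :
    ∀ {f : ℕ → ℝ × Plane → ℝ}, SmoothSeq f → IterDD S P k f →
      IterDD S P k fun n => dd u (f n) := by
  induction k with
  | zero => exact fun _ h => hP _ h
  | succ k ih =>
    refine fun {f} hf h => ⟨hP _ h.1, fun v hv => ?_⟩
    simp only [dd_comm (hf _) v u]
    exact ih (hf.dd v) (h.2 v hv)

lemma vel {R : ℝ → ℝ} (l : Fin 2) (hneg : ∀ f, P f → P fun n p => -f n p)
    (hS : ∀ v ∈ S,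
      (∀ f, ContDiff ℝ (⊤ : ℕ∞) f → SuppIn R f → dd v (_root_.vel l f) = _root_.vel l (dd v f)) ∨
      ∀ f, ContDiff ℝ (⊤ : ℕ∞) f → SuppIn R f →
        dd v (_root_.vel l f) = fun p => -_root_.vel l (dd v f) p)
    (hP : ∀ f, SmoothSeq f → (∀ n, SuppIn R (f n)) → P f → P fun n => _root_.vel l (f n)) {k : ℕ} :
    ∀ {f : ℕ → ℝ × Plane → ℝ}, SmoothSeq f → (∀ n, SuppIn R (f n)) → IterDD S P k f →
      IterDD S P k fun n => _root_.vel l (f n) := by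
  induction k with
  | zero => exact fun hf hR h => hP _ hf hR h
  | succ k ih =>
    refine fun {f} hf hR h => ⟨hP _ hf hR h.1, fun v hv => ?_⟩
    have := ih (hf.dd v) (fun n => (hR n).dd v) (h.2 v hv)
    rcases hS v hv with hS | hS
    · simpa only [hS _ (hf _) (hR _)] using this
    · simpa only [hS _ (hf _) (hR _)] using this.neg hneg

lemma of_shift (hP : ∀ f, P (fun n => f (n + 1)) → P f) {k : ℕ} :
    ∀ {f : ℕ → ℝ × Plane → ℝ}, IterDD S P k (fun n => f (n + 1)) → IterDD S P k f := by
  induction k with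
  | zero => exact fun h => hP _ h
  | succ k ih => exact fun {f} h => ⟨hP _ h.1, fun v hv => ih (h.2 v hv)⟩

lemma shift (hP : ∀ f, P f → P (fun n => f (n + 1))) {k : ℕ} :
    ∀ {f : ℕ → ℝ × Plane → ℝ}, IterDD S P k f → IterDD S P k (fun n => f (n + 1)) := by
  induction k with
  | zero => exact fun h => hP _ h
  | succ k ih => exact fun {f} h => ⟨hP _ h.1, fun v hv => ih (f := fun n => dd v (f n)) (h.2 v hv)⟩

end IterDD

namespace UBSlabs

variable {f g : ℕ → ℝ × Plane → ℝ}

lemma neg (hf : UBSlabs f) : UBSlabs fun n p => -f n p := fun T => by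
  obtain ⟨A, N, h⟩ := hf T
  exact ⟨A, N, fun n hn p hp => by simpa using h n hn p hp⟩

lemma add (hf : UBSlabs f) (hg : UBSlabs g) : UBSlabs fun n p => f n p + g n p := fun T => by
  obtain ⟨A, N, h⟩ := hf T
  obtain ⟨A', N', h'⟩ := hg T
  exact ⟨A + A', max N N', fun n hn p hp => (abs_add_le _ _).trans
    (add_le_add (h n (le_of_max_le_left hn) p hp) (h' n (le_of_max_le_right hn) p hp))⟩

lemma mul (hf : UBSlabs f) (hg : UBSlabs g) : UBSlabs fun n p => f n p * g n p := fun T => by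
  obtain ⟨A, N, h⟩ := hf T
  obtain ⟨A', N', h'⟩ := hg T
  refine ⟨A * A', max N N', fun n hn p hp => ?_⟩
  have h1 := h n (le_of_max_le_left hn) p hp
  rw [abs_mul]
  exact mul_le_mul h1 (h' n (le_of_max_le_right hn) p hp) (abs_nonneg _)
    ((abs_nonneg _).trans h1)

lemma of_shift (h : UBSlabs fun n => f (n + 1)) : UBSlabs f := fun T => by
  obtain ⟨A, N, h⟩ := h T
  refine ⟨A, N + 1, fun n hn p hp => ?_⟩
  obtain ⟨m, rfl⟩ := Nat.exists_eq_add_of_le' (show 1 ≤ n by omega)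
  exact h m (by omega) p hp

lemma shift (h : UBSlabs f) : UBSlabs fun n => f (n + 1) := fun T => by
  obtain ⟨A, N, h⟩ := h T
  exact ⟨A, N, fun n hn p hp => h (n + 1) (by omega) p hp⟩

lemma vel {R : ℝ → ℝ} (l : Fin 2) (hf : UBSlabs f) (hR : ∀ n, SuppIn R (f n)) :
    UBSlabs fun n => _root_.vel l (f n) := fun T => by
  obtain ⟨A, N, h⟩ := hf T
  refine ⟨velConst * (|A| * max 1 (R (T + 1))), N, fun n hn p hp => ?_⟩
  exact abs_vel_le l (lt_max_of_lt_left one_pos) (abs_nonneg A) p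
    (fun x => (h n hn (p.1, x) hp).trans (le_abs_self A))
    fun x hx => hR n (T + 1) (p.1, x) (by simp only; linarith) ((le_max_right _ _).trans_lt hx)

end UBSlabs

/-- All spatial derivatives are uniformly bounded on slabs. -/
def SpaceReg (f : ℕ → ℝ × Plane → ℝ) : Prop := ∀ k, IterDD (range spaceDir) UBSlabs k f

namespace SpaceReg

variable {f g : ℕ → ℝ × Plane → ℝ}

lemma of_wd (h : ∀ w, UBSlabs fun n => wd w (f n)) : SpaceReg f := by
  intro k
  suffices ∀ w, IterDD (range spaceDir) UBSlabs k fun n => wd w (f n) from this []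
  induction k with
  | zero => exact h
  | succ k ih =>
    refine fun w => ⟨h w, ?_⟩
    rintro _ ⟨i, rfl⟩
    exact ih (i :: w)

lemma dd_spaceDir (h : SpaceReg f) (i : Fin 2) : SpaceReg fun n => dd (spaceDir i) (f n) :=
  fun k => (h (k + 1)).2 _ ⟨i, rfl⟩

lemma neg (h : SpaceReg f) : SpaceReg fun n p => -f n p :=
  fun k => (h k).neg fun _ => UBSlabs.neg

lemma add (hf : SmoothSeq f) (hg : SmoothSeq g) (h : SpaceReg f) (h' : SpaceReg g) :
    SpaceReg fun n p => f n p + g n p :=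
  fun k => IterDD.add (fun _ _ _ _ => UBSlabs.add) hf hg (h k) (h' k)

lemma mul (hf : SmoothSeq f) (hg : SmoothSeq g) (h : SpaceReg f) (h' : SpaceReg g) :
    SpaceReg fun n p => f n p * g n p :=
  fun k => IterDD.mul (fun _ _ _ _ => UBSlabs.add) (fun _ _ _ _ => UBSlabs.mul) hf hg (h k) (h' k)

lemma of_shift (h : SpaceReg fun n => f (n + 1)) : SpaceReg f :=
  fun k => IterDD.of_shift (fun _ => UBSlabs.of_shift) (h k)

lemma shift (h : SpaceReg f) : SpaceReg fun n => f (n + 1) :=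
  fun k => IterDD.shift (fun _ => UBSlabs.shift) (h k)

lemma vel {R : ℝ → ℝ} (l : Fin 2) (hf : SmoothSeq f) (hR : ∀ n, SuppIn R (f n))
    (h : SpaceReg f) : SpaceReg fun n => _root_.vel l (f n) := fun k =>
  IterDD.vel l (fun _ => UBSlabs.neg)
    (by rintro _ ⟨i, rfl⟩; exact Or.inr fun f hf hfR => dd_spaceDir_vel l hf hfR i)
    (fun _ _ hR h => h.vel l hR) hf hR (h k)

end SpaceReg

/-- All derivatives are uniformly bounded on slabs. -/
def FullReg (f : ℕ → ℝ × Plane → ℝ) : Prop :=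
  SmoothSeq f ∧ ∀ m, IterDD {timeDir} SpaceReg m f

namespace FullReg

variable {f : ℕ → ℝ × Plane → ℝ}

lemma ubSlabs (h : FullReg f) : UBSlabs f := (h.2 0).base 0

lemma dd_timeDir (h : FullReg f) : FullReg fun n => dd timeDir (f n) :=
  ⟨h.1.dd _, fun m => (h.2 (m + 1)).2 _ rfl⟩

lemma dd_spaceDir (h : FullReg f) (i : Fin 2) : FullReg fun n => dd (spaceDir i) (f n) :=
  ⟨h.1.dd _, fun m => (h.2 m).dd_dir (fun _ h => h.dd_spaceDir i) h.1⟩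

end FullReg

lemma Iteration.fullReg {σ₀ : Plane → ℝ} {M r : ℝ} {σ : ℕ → ℝ × Plane → ℝ}
    (hr : 1 ≤ r) (hσ : Iteration σ₀ M r σ) : FullReg σ := by
  have hs : SmoothSeq σ := fun n => (hσ.adm n).smooth
  have hR : ∀ n, SuppIn (growRadius M r) (σ n) := fun n => (hσ.adm n).suppIn hr
  have hsp : SpaceReg σ := SpaceReg.of_wd fun w T => by
    obtain ⟨A, hA⟩ := hσ.wd_bounded hr T w.length
    exact ⟨A, 0, fun n _ p hp => hA w (by omega) n p hp⟩
  refine ⟨hs, fun m => ?_⟩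
  induction m with
  | zero => exact hsp
  | succ m ih =>
    refine ⟨hsp, ?_⟩
    rintro _ rfl
    have hs1 : SmoothSeq fun n => σ (n + 1) := fun n => hs (n + 1)
    have hv : ∀ l, SmoothSeq fun n => vel l (σ n) := fun l n => contDiff_vel l (hs n) (hR n)
    have hprod : ∀ l, SmoothSeq fun n p => vel l (σ n) p * dd (spaceDir l) (σ (n + 1)) p :=
      fun l n => (hv l n).mul (hs1.dd _ n)
    have hreg : ∀ l, IterDD {timeDir} SpaceReg m
        fun n p => vel l (σ n) p * dd (spaceDir l) (σ (n + 1)) p := fun l =>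
      IterDD.mul (fun _ _ => SpaceReg.add) (fun _ _ => SpaceReg.mul) (hv l) (hs1.dd _)
        (IterDD.vel l (fun _ => SpaceReg.neg)
          (by rintro _ rfl; exact Or.inl fun f hf hfR => dd_timeDir_vel l hf hfR)
          (fun _ hf hR h => h.vel l hf hR) hs hR ih)
        ((IterDD.shift (fun _ => SpaceReg.shift) ih).dd_dir (fun _ h => h.dd_spaceDir l) hs1)
    refine IterDD.of_shift (fun _ => SpaceReg.of_shift) ?_
    have := (IterDD.add (fun _ _ => SpaceReg.add) (hprod 0) (hprod 1) (hreg 0) (hreg 1)).neg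
      fun _ => SpaceReg.neg
    convert this using 3 with n p
    have e := congrFun (hσ.material_eq_zero n) p
    rw [material_eq] at e
    linarith

/-- Interpolation: the derivative is controlled by the function and its second derivative. -/
lemma abs_deriv_le_of_abs_deriv2_le {φ φ' φ'' : ℝ → ℝ} (h1 : ∀ s, HasDerivAt φ (φ' s) s)
    (h2 : ∀ s, HasDerivAt φ' (φ'' s) s) {K ε h : ℝ} (hh : 0 < h)
    (hK : ∀ s ∈ Icc 0 h, |φ'' s| ≤ K) (h0 : |φ 0| ≤ ε) (hε : |φ h| ≤ ε) :
    |φ' 0| ≤ 2 * ε / h + K * h := by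
  have m0 : (0 : ℝ) ∈ Icc 0 h := ⟨le_rfl, hh.le⟩
  have mh : h ∈ Icc 0 h := ⟨hh.le, le_rfl⟩
  have hK0 : 0 ≤ K := (abs_nonneg _).trans (hK 0 m0)
  have hφ' : ∀ s ∈ Icc 0 h, ‖φ' s - φ' 0‖ ≤ K * h := fun s hs => by
    have := (convex_Icc 0 h).norm_image_sub_le_of_norm_hasDerivWithin_le
      (fun s _ => (h2 s).hasDerivWithinAt) hK m0 hs
    refine this.trans ?_
    rw [sub_zero, Real.norm_eq_abs, abs_of_nonneg hs.1]
    exact mul_le_mul_of_nonneg_left hs.2 hK0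
  have := (convex_Icc 0 h).norm_image_sub_le_of_norm_hasDerivWithin_le
    (f := fun s => φ s - s * φ' 0) (f' := fun s => φ' s - φ' 0)
    (fun s _ => by
      simpa using ((h1 s).fun_sub ((hasDerivAt_id s).mul_const (φ' 0))).hasDerivWithinAt) hφ' m0 mh
  simp only [sub_zero, zero_mul, Real.norm_eq_abs, abs_of_pos hh] at this
  have key : h * |φ' 0| ≤ 2 * ε + K * h * h := by
    rw [← abs_of_pos hh, ← abs_mul, abs_of_pos hh]
    have e : h * φ' 0 = φ h - φ 0 - (φ h - h * φ' 0 - φ 0) := by ring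
    rw [e]
    have t1 := abs_sub (φ h - φ 0) (φ h - h * φ' 0 - φ 0)
    have t2 := abs_sub (φ h) (φ 0)
    linarith
  rw [show 2 * ε / h + K * h = (2 * ε + K * h * h) / h by field_simp, le_div_iff₀ hh]
  linarith

lemma hasDerivAt_line {f : ℝ × Plane → ℝ} (hf : Differentiable ℝ f) (p v : ℝ × Plane) (s : ℝ) :
    HasDerivAt (fun s => f (p + s • v)) (dd v f (p + s • v)) s := by
  have h : HasDerivAt (fun s : ℝ => p + s • v) v s := by
    simpa using ((hasDerivAt_id s).smul_const v).const_add p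
  exact (hf _).hasFDerivAt.comp_hasDerivAt s h

lemma CauchyOnSlabs.dd {f : ℕ → ℝ × Plane → ℝ} (hc : CauchyOnSlabs f) (hf : SmoothSeq f)
    {v : ℝ × Plane} (hv : |v.1| ≤ 1) (hb : UBSlabs fun n => dd v (dd v (f n))) :
    CauchyOnSlabs fun n => dd v (f n) := by
  intro T ε hε
  obtain ⟨A, N, hA⟩ := hb (T + 1)
  set h := min 1 (ε / (4 * (|A| + 1))) with hh
  have h0 : 0 < h := by positivity
  have hA1 : 2 * |A| * h ≤ ε / 2 := by
    have : h ≤ ε / (4 * (|A| + 1)) := min_le_right _ _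
    rw [le_div_iff₀ (by positivity)] at this
    nlinarith
  obtain ⟨N', hN'⟩ := hc (T + 1) (ε * h / 4) (by positivity)
  refine ⟨max N N', fun m hm n hn p hp => ?_⟩
  have hg : ContDiff ℝ (⊤ : ℕ∞) fun q => f m q - f n q := (hf m).sub (hf n)
  have hslab : ∀ s ∈ Icc 0 h, |(p + s • v).1| ≤ T + 1 := fun s hs => by
    have h1 : |s| ≤ 1 := by rw [abs_of_nonneg hs.1]; exact hs.2.trans (min_le_left _ _)
    simp only [Prod.fst_add, Prod.smul_fst, smul_eq_mul]
    refine (abs_add_le _ _).trans ?_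
    rw [abs_mul]
    have := mul_le_mul h1 hv (abs_nonneg _) zero_le_one
    linarith
  have := abs_deriv_le_of_abs_deriv2_le (K := 2 * |A|) (ε := ε * h / 4)
    (hasDerivAt_line (differentiable_of_smooth hg) p v)
    (hasDerivAt_line (differentiable_of_smooth (hg.dd v)) p v) h0 (fun s hs => ?_)
    (hN' m (le_of_max_le_right hm) n (le_of_max_le_right hn) _
      (hslab 0 ⟨le_rfl, h0.le⟩))
    (hN' m (le_of_max_le_right hm) n (le_of_max_le_right hn) _
      (hslab h ⟨h0.le, le_rfl⟩))
  · rw [dd_sub (hf.differentiable _) (hf.differentiable _)] at this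
    simp only [zero_smul, add_zero] at this
    refine this.trans ?_
    have e : 2 * (ε * h / 4) / h = ε / 2 := by field_simp; ring
    rw [e]
    linarith
  · rw [dd_sub (hf.differentiable _) (hf.differentiable _),
      dd_sub ((hf.dd v).differentiable _) ((hf.dd v).differentiable _)]
    have h1 := hA m (le_of_max_le_left hm) _ (hslab s hs)
    have h2 := hA n (le_of_max_le_left hn) _ (hslab s hs)
    have h3 := abs_sub (_root_.dd v (_root_.dd v (f m)) (p + s • v))
      (_root_.dd v (_root_.dd v (f n)) (p + s • v))
    have h4 := le_abs_self A
    linarith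

/-- The uniform limit on slabs. -/
def LimOnSlabs (f : ℕ → ℝ × Plane → ℝ) (F : ℝ × Plane → ℝ) : Prop :=
  ∀ T ε, 0 < ε → ∃ N, ∀ n ≥ N, ∀ p : ℝ × Plane, |p.1| ≤ T → |f n p - F p| ≤ ε

lemma LimOnSlabs.tendsto {f : ℕ → ℝ × Plane → ℝ} {F : ℝ × Plane → ℝ} (h : LimOnSlabs f F)
    (p : ℝ × Plane) : Filter.Tendsto (fun n => f n p) Filter.atTop (nhds (F p)) := by
  rw [Metric.tendsto_atTop]
  intro ε hε
  obtain ⟨N, hN⟩ := h |p.1| (ε / 2) (by positivity)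
  exact ⟨N, fun n hn => (hN n hn p le_rfl).trans_lt (by linarith)⟩

lemma CauchyOnSlabs.exists_lim {f : ℕ → ℝ × Plane → ℝ} (hc : CauchyOnSlabs f) :
    ∃ F, LimOnSlabs f F := by
  have hp : ∀ p, CauchySeq fun n => f n p := fun p => by
    rw [Metric.cauchySeq_iff]
    intro ε hε
    obtain ⟨N, hN⟩ := hc |p.1| (ε / 2) (by positivity)
    exact ⟨N, fun m hm n hn => (hN m hm n hn p le_rfl).trans_lt (by linarith)⟩
  choose F hF using fun p => cauchySeq_tendsto_of_complete (hp p)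
  refine ⟨F, fun T ε hε => ?_⟩
  obtain ⟨N, hN⟩ := hc T ε hε
  refine ⟨N, fun n hn p hp => ?_⟩
  exact le_of_tendsto ((tendsto_const_nhds.sub (hF p)).abs)
    (Filter.eventually_atTop.2 ⟨N, fun m hm => hN n hn m hm p hp⟩)

/-- The linear form with prescribed values on the coordinate directions of space-time. -/
def formOf : ℝ × ℝ × ℝ →L[ℝ] (ℝ × Plane →L[ℝ] ℝ) :=
  (ContinuousLinearMap.fst ℝ ℝ (ℝ × ℝ)).smulRight (ContinuousLinearMap.fst ℝ ℝ Plane)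
  + ((ContinuousLinearMap.fst ℝ ℝ ℝ).comp (ContinuousLinearMap.snd ℝ ℝ (ℝ × ℝ))).smulRight
      ((EuclideanSpace.proj (𝕜 := ℝ) (0 : Fin 2)).comp (ContinuousLinearMap.snd ℝ ℝ Plane))
  + ((ContinuousLinearMap.snd ℝ ℝ ℝ).comp (ContinuousLinearMap.snd ℝ ℝ (ℝ × ℝ))).smulRight
      ((EuclideanSpace.proj (𝕜 := ℝ) (1 : Fin 2)).comp (ContinuousLinearMap.snd ℝ ℝ Plane))

lemma fderiv_eq_formOf (f : ℝ × Plane → ℝ) (p : ℝ × Plane) :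
    fderiv ℝ f p = formOf (dd timeDir f p, dd (spaceDir 0) f p, dd (spaceDir 1) f p) := by
  refine ContinuousLinearMap.ext fun v => ?_
  have : v = v.1 • timeDir + ∑ l, v.2 l • spaceDir l := by
    refine Prod.ext ?_ ?_
    · simp [timeDir, spaceDir]
    · ext i
      fin_cases i <;> simp [timeDir, spaceDir, Fin.sum_univ_two]
  conv_lhs => rw [this]
  simp [dd, formOf, Fin.sum_univ_two]
  ring

/-- A uniformly converging sequence with locally uniformly bounded derivatives has a smooth
limit, and the derivatives converge. -/
lemma FullReg.hasFDerivAt_lim {f : ℕ → ℝ × Plane → ℝ} {F : ℝ × Plane → ℝ} (h : FullReg f)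
    (hF : LimOnSlabs f F) {a b c : ℝ × Plane → ℝ} (ha : LimOnSlabs (fun n => dd timeDir (f n)) a)
    (hb : LimOnSlabs (fun n => dd (spaceDir 0) (f n)) b)
    (hc : LimOnSlabs (fun n => dd (spaceDir 1) (f n)) c) (p : ℝ × Plane) :
    HasFDerivAt F (formOf (a p, b p, c p)) p := by
  refine hasFDerivAt_of_tendstoUniformlyOn (l := Filter.atTop) (f := f)
    (f' := fun n p => fderiv ℝ (f n) p) (g' := fun p => formOf (a p, b p, c p))
    (s := {q : ℝ × Plane | |q.1| < |p.1| + 1})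
    (isOpen_lt (by fun_prop) continuous_const) ?_
    (fun n x _ => (h.1.differentiable n x).hasFDerivAt) (fun x _ => hF.tendsto x)
    (by simp)
  simp only [fderiv_eq_formOf]
  refine formOf.uniformContinuous.comp_tendstoUniformlyOn (Metric.tendstoUniformlyOn_iff.2 ?_)
  intro ε hε
  obtain ⟨N1, h1⟩ := ha (|p.1| + 1) (ε / 2) (by positivity)
  obtain ⟨N2, h2⟩ := hb (|p.1| + 1) (ε / 2) (by positivity)
  obtain ⟨N3, h3⟩ := hc (|p.1| + 1) (ε / 2) (by positivity)
  filter_upwards [Filter.eventually_ge_atTop N1, Filter.eventually_ge_atTop N2,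
    Filter.eventually_ge_atTop N3] with n g1 g2 g3 q hq
  rw [dist_comm]
  simp only [Prod.dist_eq, Real.dist_eq]
  have hq' : |q.1| ≤ |p.1| + 1 := le_of_lt hq
  refine lt_of_le_of_lt (max_le (h1 n g1 q hq') (max_le (h2 n g2 q hq') (h3 n g3 q hq'))) ?_
  linarith

lemma FullReg.cauchy_dd_timeDir {f : ℕ → ℝ × Plane → ℝ} (h : FullReg f) (hc : CauchyOnSlabs f) :
    CauchyOnSlabs fun n => dd timeDir (f n) :=
  hc.dd h.1 (by simp [timeDir]) h.dd_timeDir.dd_timeDir.ubSlabs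

lemma FullReg.cauchy_dd_spaceDir {f : ℕ → ℝ × Plane → ℝ} (h : FullReg f) (hc : CauchyOnSlabs f)
    (i : Fin 2) : CauchyOnSlabs fun n => dd (spaceDir i) (f n) :=
  hc.dd h.1 (by simp [spaceDir]) ((h.dd_spaceDir i).dd_spaceDir i).ubSlabs

lemma FullReg.contDiff_lim {f : ℕ → ℝ × Plane → ℝ} {F : ℝ × Plane → ℝ} (h : FullReg f)
    (hc : CauchyOnSlabs f) (hF : LimOnSlabs f F) : ContDiff ℝ (⊤ : ℕ∞) F := by
  refine contDiff_infty.2 fun k => ?_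
  induction k generalizing f F with
  | zero =>
    obtain ⟨a, ha⟩ := (h.cauchy_dd_timeDir hc).exists_lim
    obtain ⟨b, hb⟩ := (h.cauchy_dd_spaceDir hc 0).exists_lim
    obtain ⟨c, hc⟩ := (h.cauchy_dd_spaceDir hc 1).exists_lim
    exact contDiff_zero.2 (continuous_iff_continuousAt.2 fun p =>
      (h.hasFDerivAt_lim hF ha hb hc p).continuousAt)
  | succ k ih =>
    have h0 := h.cauchy_dd_timeDir hc
    have h1 := h.cauchy_dd_spaceDir hc
    obtain ⟨a, ha⟩ := h0.exists_lim
    obtain ⟨b, hb⟩ := (h1 0).exists_lim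
    obtain ⟨c, hc⟩ := (h1 1).exists_lim
    push_cast
    exact contDiff_succ_iff_hasFDerivAt.2 ⟨fun p => formOf (a p, b p, c p),
      formOf.contDiff.comp ((ih h.dd_timeDir h0 ha).prodMk
        ((ih (h.dd_spaceDir 0) (h1 0) hb).prodMk (ih (h.dd_spaceDir 1) (h1 1) hc))),
      h.hasFDerivAt_lim hF ha hb hc⟩

lemma FullReg.tendsto_fderiv {f : ℕ → ℝ × Plane → ℝ} {F : ℝ × Plane → ℝ} (h : FullReg f)
    (hc : CauchyOnSlabs f) (hF : LimOnSlabs f F) (p : ℝ × Plane) :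
    Filter.Tendsto (fun n => fderiv ℝ (f n) p) Filter.atTop (nhds (fderiv ℝ F p)) := by
  obtain ⟨a, ha⟩ := (h.cauchy_dd_timeDir hc).exists_lim
  obtain ⟨b, hb⟩ := (h.cauchy_dd_spaceDir hc 0).exists_lim
  obtain ⟨c, hc⟩ := (h.cauchy_dd_spaceDir hc 1).exists_lim
  rw [(h.hasFDerivAt_lim hF ha hb hc p).fderiv]
  simp only [fderiv_eq_formOf]
  exact (formOf.continuous.tendsto _).comp
    ((ha.tendsto p).prodMk_nhds ((hb.tendsto p).prodMk_nhds (hc.tendsto p)))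

lemma LimOnSlabs.vel (l : Fin 2) {R : ℝ → ℝ} {f : ℕ → ℝ × Plane → ℝ} {F : ℝ × Plane → ℝ}
    (h : LimOnSlabs f F) (hf : SmoothSeq f) (hR : ∀ n, SuppIn R (f n))
    (hF : ContDiff ℝ (⊤ : ℕ∞) F) (hFR : SuppIn R F) :
    LimOnSlabs (fun n => vel l (f n)) (vel l F) := by
  intro T ε hε
  set R' := max 1 (R (T + 1))
  have hR' : 0 < R' := lt_max_of_lt_left one_pos
  have hC := velConst_nonneg
  obtain ⟨N, hN⟩ := h T (ε / (velConst * R' + 1)) (by positivity)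
  refine ⟨N, fun n hn p hp => ?_⟩
  refine (abs_vel_sub_le l (hf n) (hR n) hF hFR hR' (le_max_right _ _)
    (by positivity) (by linarith) fun x => hN n hn (p.1, x) hp).trans ?_
  rw [show velConst * (ε / (velConst * R' + 1) * R')
    = ε * (velConst * R') / (velConst * R' + 1) by ring, div_le_iff₀ (by positivity)]
  nlinarith [mul_nonneg hC hR'.le]

/-- Global smooth solutions of the transport equation whose velocity field is generated by the
point reflection of the transported function. -/
theorem exists_global_solution {σ₀ : Plane → ℝ} {M r : ℝ} (hr : 1 ≤ r)
    (h0 : ContDiff ℝ (⊤ : ℕ∞) σ₀) (hM : ∀ x, |σ₀ x| ≤ M) (hs : ∀ x, r < ‖x‖ → σ₀ x = 0) :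
    ∃ σ, Admissible σ₀ M r σ ∧ ∀ p, fderiv ℝ σ p (1, velField σ p) = 0 := by
  obtain ⟨σ, hσ⟩ := exists_iteration hr h0 hM hs
  have hreg := hσ.fullReg hr
  have hc := hσ.cauchyOnSlabs hr
  obtain ⟨F, hF⟩ := hc.exists_lim
  have hlim := hF.tendsto
  have hA : Admissible σ₀ M r F :=
    { smooth := hreg.contDiff_lim hc hF
      initial := fun x => tendsto_nhds_unique (hlim (0, x)) (by
        simp only [(hσ.adm _).initial]; exact tendsto_const_nhds)
      bound := fun p => le_of_tendsto (hlim p).abs (Filter.Eventually.of_forall fun n =>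
        (hσ.adm n).bound p)
      supp := fun p hp => tendsto_nhds_unique (hlim p) (by
        simp only [(hσ.adm _).supp p hp]; exact tendsto_const_nhds) }
  refine ⟨F, hA, fun p => ?_⟩
  have hv : ∀ l, Filter.Tendsto (fun n => vel l (σ n) p) Filter.atTop (nhds (vel l F p)) :=
    fun l => (hF.vel l hreg.1 (fun n => (hσ.adm n).suppIn hr) hA.smooth (hA.suppIn hr)).tendsto p
  have hd : ∀ v, Filter.Tendsto (fun n => dd v (σ (n + 1)) p) Filter.atTop (nhds (dd v F p)) :=
    fun v => ((ContinuousLinearMap.apply ℝ ℝ v).continuous.tendsto _).comp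
      ((hreg.tendsto_fderiv hc hF p).comp (Filter.tendsto_add_atTop_nat 1))
  have key : Filter.Tendsto (fun n => material (σ n) (σ (n + 1)) p) Filter.atTop
      (nhds (material F F p)) := by
    simp only [material_eq]
    exact (hd _).add (((hv 0).mul (hd _)).add ((hv 1).mul (hd _)))
  simp only [hσ.material_eq_zero] at key
  exact tendsto_nhds_unique key tendsto_const_nhds

lemma bsKernel_neg (z : Plane) : bsKernel (-z) = -bsKernel z := by
  have : perp (-z) = -perp z := map_neg perpL z
  rw [bsKernel, bsKernel, norm_neg, this, smul_neg]

lemma biotSavart_neg (ω : Plane → ℝ) (x : Plane) :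
    biotSavart (fun y => -ω y) x = -biotSavart ω x := by
  simp only [biotSavart_eq, neg_smul, integral_neg]

lemma biotSavart_reflect (ω : Plane → ℝ) (x : Plane) :
    biotSavart (fun y => ω (-y)) (-x) = -biotSavart ω x := by
  simp only [biotSavart_eq]
  rw [← integral_neg_eq_self, ← integral_neg]
  refine integral_congr_ae (Filter.Eventually.of_forall fun z => ?_)
  simp only [bsKernel_neg, smul_neg]
  congr 3
  abel

lemma Admissible.velField_eq {σ₀ : Plane → ℝ} {M r : ℝ} {σ : ℝ × Plane → ℝ}
    (hσ : Admissible σ₀ M r σ) (t : ℝ) (x : Plane) :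
    velField σ (t, x) = biotSavart (fun y => σ (t, -y)) x := by
  refine velField_eq_biotSavart σ (t, x) ?_
  have hc : Continuous fun z => σ (t, -(x - z)) := hσ.smooth.continuous.comp (by fun_prop)
  refine locallyIntegrable_bsKernel.integrable_smul_left_of_hasCompactSupport hc
    (HasCompactSupport.of_support_subset_isCompact
      (isCompact_closedBall x (growRadius M r |t|)) fun z hz => ?_)
  by_contra h
  refine hz (hσ.supp (t, -(x - z)) ?_)
  simpa [dist_eq_norm, norm_sub_rev] using h

lemma Admissible.hasCompactSupport {σ₀ : Plane → ℝ} {M r : ℝ} {σ : ℝ × Plane → ℝ}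
    (hσ : Admissible σ₀ M r σ) (t : ℝ) : HasCompactSupport fun x => σ (t, x) := by
  refine HasCompactSupport.of_support_subset_isCompact
    (isCompact_closedBall (0 : Plane) (growRadius M r |t|)) fun z hz => ?_
  by_contra h
  exact hz (hσ.supp (t, z) (by simpa using h))

lemma deriv_time_slice {f : ℝ × Plane → ℝ} (hf : Differentiable ℝ f) (s t : ℝ) (x : Plane) :
    deriv (fun τ => f (τ - s, x)) t = fderiv ℝ f (t - s, x) (1, 0) := by
  have h : HasDerivAt (fun τ : ℝ => (τ - s, x)) ((1 : ℝ), (0 : Plane)) t :=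
    ((hasDerivAt_id t).sub_const s).prodMk (hasDerivAt_const t x)
  exact ((hf _).hasFDerivAt.comp_hasDerivAt t h).deriv

lemma fderiv_space_slice {f : ℝ × Plane → ℝ} (hf : Differentiable ℝ f) (t : ℝ) (x v : Plane) :
    fderiv ℝ (fun y => f (t, y)) x v = fderiv ℝ f (t, x) (0, v) := by
  rw [(hasFDerivAt_slice hf t x).fderiv]
  rfl

lemma fderiv_reflect_slice {f : ℝ × Plane → ℝ} (hf : Differentiable ℝ f) (t : ℝ) (x v : Plane) :
    fderiv ℝ (fun y => -f (t, -y)) x v = fderiv ℝ f (t, -x) (0, v) := by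
  have := ((hasFDerivAt_slice hf t (-x)).comp x (hasFDerivAt_id x).neg).neg
  refine (congrArg (fun L : Plane →L[ℝ] ℝ => L v) this.fderiv).trans ?_
  simp [-Prod.neg_mk]

/-- A solution of the reflected transport equation yields a solution of the coupled system. -/
lemma Admissible.solves {σ₀ : Plane → ℝ} {M r : ℝ} {σ : ℝ × Plane → ℝ}
    (hσ : Admissible σ₀ M r σ) (h : ∀ p, fderiv ℝ σ p (1, velField σ p) = 0) (s t : ℝ)
    (x : Plane) :
    deriv (fun τ => σ (τ - s, x)) t
      - fderiv ℝ (fun y => σ (t - s, y)) x (biotSavart (fun y => -σ (t - s, -y)) x) = 0 ∧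
    deriv (fun τ => -σ (τ - s, -x)) t
      + fderiv ℝ (fun y => -σ (t - s, -y)) x (biotSavart (fun y => σ (t - s, y)) x) = 0 := by
  have hd := differentiable_of_smooth hσ.smooth
  have key : ∀ y w : Plane, velField σ (t - s, y) = w →
      fderiv ℝ σ (t - s, y) (1, 0) + fderiv ℝ σ (t - s, y) (0, w) = 0 := by
    rintro y _ rfl
    rw [← map_add]
    simpa using h (t - s, y)
  constructor
  · rw [deriv_time_slice hd, fderiv_space_slice hd, biotSavart_neg, ← hσ.velField_eq]
    have e : ((0 : ℝ), -velField σ (t - s, x)) = -(0, velField σ (t - s, x)) := by simp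
    rw [e, map_neg, sub_neg_eq_add]
    exact key x _ rfl
  · have e1 : deriv (fun τ => -σ (τ - s, -x)) t = -fderiv ℝ σ (t - s, -x) (1, 0) := by
      rw [← deriv_time_slice hd]
      exact deriv.fun_neg
    rw [e1, fderiv_reflect_slice hd]
    have := key (-x) (-biotSavart (fun y => σ (t - s, y)) x) (by
      rw [hσ.velField_eq]
      exact biotSavart_reflect (fun y => σ (t - s, y)) x)
    have e : ((0 : ℝ), -biotSavart (fun y => σ (t - s, y)) x)
      = -(0, biotSavart (fun y => σ (t - s, y)) x) := by simp
    rw [e, map_neg] at this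
    linarith

lemma norm_sq_plane (x : Plane) : ‖x‖ ^ 2 = x 0 ^ 2 + x 1 ^ 2 := by
  simp [EuclideanSpace.norm_sq_eq, Fin.sum_univ_two]

lemma abs_apply_le_norm (x : Plane) (i : Fin 2) : |x i| ≤ ‖x‖ := PiLp.norm_apply_le x i

lemma mem_ball_plane (x : Plane) (a b : ℝ) :
    x ∈ Metric.ball (!₂[a, b] : Plane) 1 ↔ (x 0 - a) ^ 2 + (x 1 - b) ^ 2 < 1 := by
  rw [Metric.mem_ball, dist_eq_norm, ← sq_lt_one_iff₀ (norm_nonneg _), norm_sq_plane]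
  simp

lemma bsComp_one (z : Plane) : bsComp 1 z = 1 / (2 * Real.pi) * (‖z‖ ^ 2)⁻¹ * z 0 := by
  simp [bsComp, bsKernel, perp]

/-- The bump function supported in the unit disc around `(a, b)`. -/
def discBump (a b : ℝ) : ContDiffBump (!₂[a, b] : Plane) :=
  ⟨1 / 2, 1, by norm_num, by norm_num⟩

lemma discBump_ne_zero_iff (a b : ℝ) (x : Plane) :
    discBump a b x ≠ 0 ↔ (x 0 - a) ^ 2 + (x 1 - b) ^ 2 < 1 := by
  rw [← mem_ball_plane, ← Function.mem_support, ContDiffBump.support_eq]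
  rfl

lemma integrable_bsComp_mul_discBump (l : Fin 2) (a b : ℝ) :
    Integrable fun z => bsComp l z * discBump a b z := by
  have := (locallyIntegrable_bsComp l).integrable_smul_right_of_hasCompactSupport
    (discBump a b).continuous (discBump a b).hasCompactSupport
  simpa [smul_eq_mul, mul_comm] using this

lemma integral_bsComp_one_mul_discBump_pos : 0 < ∫ z, bsComp 1 z * discBump 5 3 z := by
  have hpi := Real.pi_pos
  have hz0 : ∀ z : Plane, discBump 5 3 z ≠ 0 → 0 < bsComp 1 z := fun z hz => by
    rw [discBump_ne_zero_iff] at hz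
    have h0 : 0 < z 0 := by nlinarith [sq_nonneg (z 1 - 3)]
    have hn : 0 < ‖z‖ ^ 2 := by rw [norm_sq_plane]; positivity
    rw [bsComp_one]
    positivity
  rw [integral_pos_iff_support_of_nonneg (fun z => ?_) (integrable_bsComp_mul_discBump 1 5 3)]
  · refine (Metric.measure_ball_pos volume (!₂[5, 3] : Plane) one_pos).trans_le
      (measure_mono fun z hz => ?_)
    have h : discBump 5 3 z ≠ 0 := (discBump_ne_zero_iff 5 3 z).2 ((mem_ball_plane z 5 3).1 hz)
    exact mul_ne_zero (hz0 z h).ne' h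
  · by_cases h : discBump 5 3 z = 0
    · simp [h]
    · exact mul_nonneg (hz0 z h).le (discBump 5 3).nonneg

/-- An initial datum touching the origin from the upper half-plane whose velocity at the origin
points downwards. -/
lemma exists_initial_datum : ∃ (σ₀ : Plane → ℝ) (M r : ℝ), 1 ≤ r ∧ ContDiff ℝ (⊤ : ℕ∞) σ₀ ∧
    (∀ x, |σ₀ x| ≤ M) ∧ (∀ x, r < ‖x‖ → σ₀ x = 0) ∧ ∫ z, bsComp 1 z * σ₀ z = -1 ∧
    (∀ x, ‖x‖ ≤ 1 → ‖x‖ ^ 2 < 2 * x 1 → σ₀ x ≠ 0) ∧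
    ∀ x, σ₀ x ≠ 0 → ‖x‖ ^ 2 < 2 * x 1 ∨ 2 < x 1 := by
  set I₁ := ∫ z, bsComp 1 z * discBump 0 1 z with hI₁
  set I₂ := ∫ z, bsComp 1 z * discBump 5 3 z with hI₂
  have hI₂0 : 0 < I₂ := integral_bsComp_one_mul_discBump_pos
  set β := (-1 - I₁) / I₂ with hβ
  have hsupp : ∀ x : Plane, discBump 0 1 x + β * discBump 5 3 x ≠ 0 →
      discBump 0 1 x ≠ 0 ∨ discBump 5 3 x ≠ 0 := fun x hx => by
    by_contra! h
    simp [h.1, h.2] at hx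
  refine ⟨fun x => discBump 0 1 x + β * discBump 5 3 x, 1 + |β|, 10, by norm_num,
    (discBump 0 1).contDiff.add (contDiff_const.mul (discBump 5 3).contDiff),
    fun x => ?_, fun x hx => ?_, ?_, fun x hx1 hx => ?_, fun x hx => ?_⟩
  · have h1 : |discBump 0 1 x| ≤ 1 := by
      rw [abs_of_nonneg (discBump 0 1).nonneg]; exact (discBump 0 1).le_one
    have h2 : |discBump 5 3 x| ≤ 1 := by
      rw [abs_of_nonneg (discBump 5 3).nonneg]; exact (discBump 5 3).le_one
    refine (abs_add_le _ _).trans ?_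
    rw [abs_mul]
    nlinarith [abs_nonneg β]
  · by_contra h
    have hn : 100 < ‖x‖ ^ 2 := by nlinarith
    rw [norm_sq_plane] at hn
    rcases hsupp x h with h | h
    · rw [discBump_ne_zero_iff] at h
      nlinarith [sq_nonneg (x 0), sq_nonneg (x 1 - 2)]
    · rw [discBump_ne_zero_iff] at h
      have h0 : x 0 < 6 ∧ -6 < x 0 := by constructor <;> nlinarith [sq_nonneg (x 1 - 3)]
      have h1 : x 1 < 4 ∧ -4 < x 1 := by constructor <;> nlinarith [sq_nonneg (x 0 - 5)]
      nlinarith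
  · simp only [mul_add]
    rw [integral_add (integrable_bsComp_mul_discBump 1 0 1)]
    · have : ∀ z, bsComp 1 z * (β * discBump 5 3 z) = β * (bsComp 1 z * discBump 5 3 z) :=
        fun z => by ring
      simp only [this, integral_const_mul]
      rw [← hI₁, ← hI₂, hβ]
      field_simp
      ring
    · refine ((integrable_bsComp_mul_discBump 1 5 3).const_mul β).congr
        (Filter.Eventually.of_forall fun z => ?_)
      simp only
      ring
  · have h2 : discBump 5 3 x = 0 := by
      by_contra h
      rw [← ne_eq, discBump_ne_zero_iff] at h
      have := (le_abs_self _).trans ((abs_apply_le_norm x 0).trans hx1)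
      nlinarith [sq_nonneg (x 1 - 3)]
    simp only [h2, mul_zero, add_zero]
    rw [discBump_ne_zero_iff]
    rw [norm_sq_plane] at hx
    linarith
  · rcases hsupp x hx with h | h
    · left
      rw [discBump_ne_zero_iff] at h
      rw [norm_sq_plane]
      linarith
    · right
      rw [discBump_ne_zero_iff] at h
      nlinarith [sq_nonneg (x 0 - 5)]

section Trajectories

variable {V : ℝ × Plane → Plane} {X : ℝ → Plane} {S δ : ℝ}

lemma norm_trajectory_sub_le (hX : ∀ t, HasDerivAt X (V (t, X t)) t)
    (hS : ∀ p : ℝ × Plane, |p.1| ≤ 1 → ‖V p‖ ≤ S) {s t : ℝ} (hs : |s| ≤ 1) (ht : |t| ≤ 1) :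
    ‖X t - X s‖ ≤ S * |t - s| :=
  (convex_Icc (-1) 1).norm_image_sub_le_of_norm_hasDerivWithin_le
    (fun τ _ => (hX τ).hasDerivWithinAt) (fun _ hτ => hS _ (abs_le.2 hτ)) (abs_le.1 hs)
    (abs_le.1 ht)

lemma trajectory_descends (hX : ∀ t, HasDerivAt X (V (t, X t)) t)
    (hδ : ∀ p : ℝ × Plane, |p.1| ≤ δ → ‖p.2‖ ≤ δ → V p 1 ≤ -(1 / 2)) {a b : ℝ} (hab : a ≤ b)
    (ha : -δ ≤ a) (hb : b ≤ δ) (h : ∀ t ∈ Icc a b, ‖X t‖ ≤ δ) :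
    X b 1 - X a 1 ≤ -(1 / 2) * (b - a) := by
  have hd : ∀ t, HasDerivAt (fun t => X t 1) (V (t, X t) 1) t := fun t =>
    ((EuclideanSpace.proj (𝕜 := ℝ) (1 : Fin 2)).hasFDerivAt.comp_hasDerivAt t (hX t))
  refine (convex_Icc a b).image_sub_le_mul_sub_of_deriv_le
    (fun t _ => (hd t).continuousAt.continuousWithinAt)
    (fun t _ => (hd t).differentiableAt.differentiableWithinAt) (fun t ht => ?_) a
    (left_mem_Icc.2 hab) b (right_mem_Icc.2 hab) hab
  rw [(hd t).deriv]
  have ht' := interior_subset ht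
  exact hδ _ (abs_le.2 ⟨ha.trans ht'.1, ht'.2.trans hb⟩) (h t ht')

end Trajectories

/-- Along the flow, the support of the solution crosses the origin. -/
lemma exists_crossing : ∃ (σ₀ : Plane → ℝ) (M r : ℝ) (σ : ℝ × Plane → ℝ) (s c : ℝ),
    Admissible σ₀ M r σ ∧ (∀ p, fderiv ℝ σ p (1, velField σ p) = 0) ∧ 0 < s ∧ 0 < c ∧
    σ (s, 0) ≠ 0 ∧ ∀ x, σ (-s, x) ≠ 0 → c ≤ x 1 := by
  obtain ⟨σ₀, M, r, hr, h0, hM, hsupp, hintegral, hin, hout⟩ := exists_initial_datum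
  obtain ⟨σ, hσ, heq⟩ := exists_global_solution hr h0 hM hsupp
  refine ⟨σ₀, M, r, σ, ?_⟩
  have hV := hσ.hasTrajectories hr
  have hconst := fun {X : ℝ → Plane} =>
    const_along (X := X) (differentiable_of_smooth hσ.smooth) heq
  have hcont : Continuous (velField σ) := (contDiff_velField hσ.smooth (hσ.suppIn hr)).continuous
  obtain ⟨S, hS1, hS⟩ : ∃ S, 1 ≤ S ∧ ∀ p : ℝ × Plane, |p.1| ≤ 1 → ‖velField σ p‖ ≤ S := by
    refine ⟨max 1 (2 * velConst * (M * growRadius M r 1)), le_max_left _ _, fun p hp =>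
      (hσ.norm_velField_le hr p).trans (le_trans ?_ (le_max_right _ _))⟩
    have h1 := growRadius_mono hσ.nonneg hr hp
    have h2 := velConst_nonneg
    have h3 := hσ.nonneg
    gcongr
  have hV0 : velField σ (0, 0) 1 = -1 := by
    rw [velField_apply, vel, conv, ← hintegral]
    simp [reflect, hσ.initial]
  obtain ⟨δ, hδ0, hδ1, hδ⟩ : ∃ δ, 0 < δ ∧ δ ≤ 1 ∧ ∀ p : ℝ × Plane, |p.1| ≤ δ → ‖p.2‖ ≤ δ →
      velField σ p 1 ≤ -(1 / 2) := by
    have hc : ContinuousAt (fun p => velField σ p 1) (0, 0) :=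
      ((EuclideanSpace.proj (𝕜 := ℝ) (1 : Fin 2)).continuous.comp hcont).continuousAt
    have he := hc.eventually (gt_mem_nhds (show velField σ (0, 0) 1 < -(1 / 2) by
      rw [hV0]; norm_num))
    obtain ⟨ε, hε, h⟩ := Metric.eventually_nhds_iff.1 he
    refine ⟨min 1 (ε / 2), by positivity, min_le_left _ _, fun p h1 h2 => (h ?_).le⟩
    have h3 : min 1 (ε / 2) < ε := (min_le_right _ _).trans_lt (by linarith)
    rw [Prod.dist_eq]
    refine max_lt ?_ ?_
    · simpa using h1.trans_lt h3
    · simpa using h2.trans_lt h3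
  set s := δ ^ 2 / (16 * S ^ 2) with hs
  have hs0 : 0 < s := by positivity
  have hSs : S * s ≤ δ ^ 2 / 16 := by
    rw [hs, show S * (δ ^ 2 / (16 * S ^ 2)) = δ ^ 2 / 16 / S by field_simp]
    exact div_le_self (by positivity) hS1
  have hSSs : S ^ 2 * s < 1 := by
    rw [hs, show S ^ 2 * (δ ^ 2 / (16 * S ^ 2)) = δ ^ 2 / 16 by field_simp]
    nlinarith
  have hss : s ≤ S * s := by nlinarith
  have hδs : δ ^ 2 / 16 ≤ δ / 2 := by nlinarith
  have habs : |s| ≤ 1 := by rw [abs_of_pos hs0]; linarith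
  have h01 : |(0 : ℝ)| ≤ 1 := by simp
  refine ⟨s, min (s / 2) (δ ^ 2 / 16), hσ, heq, hs0, by positivity, ?_, fun x hx => ?_⟩
  · obtain ⟨X, hXs, hX⟩ := hV (s, 0)
    simp only at hXs
    rw [← hXs, hconst hX s 0, hσ.initial]
    have hb : ∀ t ∈ Icc 0 s, ‖X t‖ ≤ S * s := fun t ht => by
      have h1 : |t| ≤ 1 := by rw [abs_of_nonneg ht.1]; linarith [ht.2]
      have := norm_trajectory_sub_le hX hS habs h1
      rw [hXs, sub_zero, abs_sub_comm, abs_of_nonneg (by linarith [ht.2])] at this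
      refine this.trans (mul_le_mul_of_nonneg_left (by linarith [ht.1]) (by linarith))
    have h1 := trajectory_descends hX hδ hs0.le (by linarith) (by linarith)
      fun t ht => (hb t ht).trans (by linarith)
    have h2 := hb 0 ⟨le_rfl, hs0.le⟩
    rw [hXs] at h1
    simp only [PiLp.zero_apply, sub_zero, zero_sub] at h1
    refine hin _ (by linarith) ?_
    have h3 : ‖X 0‖ ^ 2 ≤ (S * s) ^ 2 := by gcongr
    nlinarith
  · obtain ⟨X, hXs, hX⟩ := hV (-s, x)
    simp only at hXs
    rw [← hXs, hconst hX (-s) 0, hσ.initial] at hx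
    rw [← hXs]
    have hb : ∀ t ∈ Icc (-s) 0, ‖X t - X 0‖ ≤ S * s := fun t ht => by
      have h1 : |t| ≤ 1 := by rw [abs_of_nonpos ht.2]; linarith [ht.1]
      refine (norm_trajectory_sub_le hX hS h01 h1).trans ?_
      rw [sub_zero, abs_of_nonpos ht.2]
      exact mul_le_mul_of_nonneg_left (by linarith [ht.1]) (by linarith)
    have hy : 0 ≤ X 0 1 := by
      rcases hout _ hx with h | h
      · nlinarith [sq_nonneg ‖X 0‖]
      · linarith
    by_cases hX0 : ‖X 0‖ ≤ δ / 2
    · have h1 := trajectory_descends hX hδ (neg_nonpos.2 hs0.le) (by linarith) hδ0.le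
        fun t ht => by
          have h2 := hb t ht
          have h3 := norm_sub_norm_le (X t) (X 0)
          linarith
      refine (min_le_left _ _).trans ?_
      linarith
    · refine (min_le_right _ _).trans ?_
      have h1 := (abs_apply_le_norm _ 1).trans (hb (-s) ⟨le_rfl, by linarith⟩)
      have h2 : X 0 1 - X (-s) 1 ≤ S * s := by
        have := neg_abs_le ((X (-s) - X 0) 1)
        simp only [PiLp.sub_apply] at this h1
        linarith
      have h3 : δ ^ 2 / 8 ≤ X 0 1 := by
        rcases hout _ hx with h | h
        · push Not at hX0
          nlinarith
        · nlinarith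
      linarith

/-- Finite-time merger for the unscreened right-handed system:
there exist `T > 0` and smooth, compactly supported solutions `σ₊, σ₋` on `[0,∞)`
of `∂ₜσ₊ − 𝕌(σ₋)·∇σ₊ = 0`, `∂ₜσ₋ + 𝕌(σ₊)·∇σ₋ = 0` whose supports are disjoint at
time `0` while the interiors of the supports overlap at time `T`. -/
theorem unscreened_merger_exists :
    ∃ (T : ℝ), 0 < T ∧
    ∃ σp σm : ℝ → EuclideanSpace ℝ (Fin 2) → ℝ,
      (ContDiff ℝ (⊤ : ℕ∞) fun p : ℝ × EuclideanSpace ℝ (Fin 2) => σp p.1 p.2) ∧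
      (ContDiff ℝ (⊤ : ℕ∞) fun p : ℝ × EuclideanSpace ℝ (Fin 2) => σm p.1 p.2) ∧
      (∀ t, HasCompactSupport (σp t)) ∧ (∀ t, HasCompactSupport (σm t)) ∧
      (∀ t ≥ (0:ℝ), ∀ x,
        deriv (fun s => σp s x) t - fderiv ℝ (σp t) x (biotSavart (σm t) x) = 0 ∧
        deriv (fun s => σm s x) t + fderiv ℝ (σm t) x (biotSavart (σp t) x) = 0) ∧
      tsupport (σp 0) ∩ tsupport (σm 0) = ∅ ∧
      (interior (tsupport (σp T)) ∩ interior (tsupport (σm T))).Nonempty := by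
  obtain ⟨σ₀, M, r, σ, s, c, hσ, heq, hs, hc, hne, hup⟩ := exists_crossing
  have hcont : Continuous σ := hσ.smooth.continuous
  refine ⟨2 * s, by positivity, fun t x => σ (t - s, x), fun t x => -σ (t - s, -x),
    hσ.smooth.comp ((contDiff_fst.sub contDiff_const).prodMk contDiff_snd),
    (hσ.smooth.comp ((contDiff_fst.sub contDiff_const).prodMk contDiff_snd.neg)).neg,
    fun t => hσ.hasCompactSupport (t - s), fun t => ?_, fun t _ x => hσ.solves heq s t x, ?_, 0,
    ?_, ?_⟩
  · exact ((hσ.hasCompactSupport (t - s)).comp_homeomorph (Homeomorph.neg Plane)).neg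
  · have h1 : tsupport (fun x => σ (0 - s, x)) ⊆ {x : Plane | c ≤ x 1} :=
      closure_minimal (fun x hx => hup x (by simpa using hx))
        (isClosed_le continuous_const (by fun_prop))
    have h2 : tsupport (fun x => -σ (0 - s, -x)) ⊆ {x : Plane | c ≤ -x 1} :=
      closure_minimal (fun x hx => by simpa using hup (-x) (by simpa using hx))
        (isClosed_le continuous_const (by fun_prop))
    refine eq_empty_of_forall_notMem fun x hx => ?_
    have a1 : c ≤ x 1 := h1 hx.1
    have a2 : c ≤ -x 1 := h2 hx.2
    linarith
  · refine interior_maximal (subset_tsupport _) (IsOpen.preimage (f := fun x => σ (2 * s - s, x))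
      (by fun_prop) isOpen_compl_singleton) ?_
    simpa [two_mul] using hne
  · refine interior_maximal (subset_tsupport _)
      (IsOpen.preimage (f := fun x => -σ (2 * s - s, -x)) (by fun_prop) isOpen_compl_singleton) ?_
    simpa [two_mul] using hne

end
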